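/- arXiv:1303.0969 — 5 statements merged into one kernel-verified Lean document; each statement's English description precedes it below -/
import Mathlib

section
/- Let α ∈ (0,1) be irrational, ρ ∈ [0,1), and n ≥ 1. Then the prefix of length n of the Sturmian word u_{α,ρ} is light (i.e., the number of occurrences of the letter 0 in it equals ⌊nα⌋ + 1) if and only if ρ ∈ [0, frac(nα)), and it is heavy (i.e., the number of occurrences of 0 in it equals ⌊nα⌋) if and only if ρ ∈ [frac(nα), 1). Here frac denotes the fractional part, and frac(nα) = T_α^{−(n−1)}(α). -/
open Set

noncomputable section

/-- Exchange of two intervals with parameter `α`, acting on `[0,1)`: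
`T_α(x) = x + 1 - α` for `x ∈ [0,α)` and `T_α(x) = x - α` for `x ∈ [α,1)`. -/
def twoIE (α x : ℝ) : ℝ := if x < α then x + 1 - α else x - α

/-- The Sturmian word with slope `α` and intercept `ρ`:
`false` codes the letter 0 (i.e. `T_α^n(ρ) ∈ [0,α)`), `true` codes the letter 1. -/
def sturmian (α ρ : ℝ) (n : ℕ) : Bool := if α ≤ (twoIE α)^[n] ρ then true else false

/-- The factor of length `n` of an infinite word `u` starting at position `i`. -/
def seg (u : ℕ → Bool) (i n : ℕ) : List Bool := (List.range n).map (fun j => u (i + j))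

/-- The prefix of length `n` of `u`. -/
def wordPrefix (u : ℕ → Bool) (n : ℕ) : List Bool := seg u 0 n

/-- Return time of `x` to the set `I` under `twoIE α`:
the least `m ≥ 1` such that `T_α^m(x) ∈ I`. -/
def returnTime (α : ℝ) (I : Set ℝ) (x : ℝ) : ℕ :=
  sInf {m : ℕ | 0 < m ∧ (twoIE α)^[m] x ∈ I}

/-- The `I`-itinerary of `x`: the prefix of length `returnTime α I x` of the
Sturmian word with slope `α` and intercept `x`. -/
def itin (α : ℝ) (I : Set ℝ) (x : ℝ) : List Bool :=
  wordPrefix (sturmian α x) (returnTime α I x)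

/-- Two binary words are abelian equivalent if they have the same length and the
same number of occurrences of the letter 0 (coded by `false`). -/
def AbEquiv (w w' : List Bool) : Prop :=
  w.length = w'.length ∧ w.count false = w'.count false

/-- `w` is a factor of the infinite word `u`. -/
def IsFactor (u : ℕ → Bool) (w : List Bool) : Prop := ∃ i, seg u i w.length = w

/-- Positions of occurrences in `u` of factors abelian equivalent to `w`. -/
def abOcc (u : ℕ → Bool) (w : List Bool) : Set ℕ :=
  {i | AbEquiv (seg u i w.length) w}

/-- The set of abelian return words to `w` in `u`: the words of `u` lying between
two consecutive occurrences of factors abelian equivalent to `w`. -/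
def AR (u : ℕ → Bool) (w : List Bool) : Set (List Bool) :=
  {v | ∃ i j : ℕ, i ∈ abOcc u w ∧ j ∈ abOcc u w ∧ i < j ∧
        (∀ m, i < m → m < j → m ∉ abOcc u w) ∧ v = seg u i (j - i)}

/-- The set of abelian return words to all nonempty prefixes of `u`. -/
def APR (u : ℕ → Bool) : Set (List Bool) :=
  ⋃ n ∈ {n : ℕ | 1 ≤ n}, AR u (wordPrefix u n)

/-- `S_β`: the set of `[0,β)`-itineraries under `twoIE α`. -/
def Sitin (α β : ℝ) : Set (List Bool) :=
  {w | ∃ x ∈ Ico (0:ℝ) β, itin α (Ico (0:ℝ) β) x = w}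

/-- `R^α_ρ`: the union of the sets of `[0,β)`-itineraries over `ρ ≤ β < 1`. -/
def Rlight (α ρ : ℝ) : Set (List Bool) := ⋃ β ∈ Ico ρ 1, Sitin α β

/-- `R'^α_ρ`: the union of the sets of `[γ,1)`-itineraries over `0 < γ ≤ ρ`. -/
def Rheavy (α ρ : ℝ) : Set (List Bool) :=
  ⋃ γ ∈ Ioc (0:ℝ) ρ, {w | ∃ x ∈ Ico γ 1, itin α (Ico γ 1) x = w}

/-- The Gauss map `x ↦ {1/x}`. -/
def gaussMap (x : ℝ) : ℝ := Int.fract x⁻¹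

/-- The `k`-th partial quotient `a_k` (for `k ≥ 1`) of the continued fraction
expansion `α = [0; a_1, a_2, …]` of `α ∈ (0,1)`. -/
def cfa (α : ℝ) (k : ℕ) : ℕ := ⌊(gaussMap^[k - 1] α)⁻¹⌋₊

/-- `cfPQ α n = (p_{n-1}, q_{n-1})`, numerators and denominators of the convergents
of `α`: `p_{-1} = 1`, `q_{-1} = 0`, `p_0 = 0`, `q_0 = 1`,
`p_k = a_k p_{k-1} + p_{k-2}`, `q_k = a_k q_{k-1} + q_{k-2}`. -/
def cfPQ (α : ℝ) : ℕ → ℤ × ℤ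
  | 0 => (1, 0)
  | 1 => (0, 1)
  | (k + 2) => ((cfa α (k + 1) : ℤ) * (cfPQ α (k + 1)).1 + (cfPQ α k).1,
                (cfa α (k + 1) : ℤ) * (cfPQ α (k + 1)).2 + (cfPQ α k).2)

/-- `δ_{k,s} = |(s-1)(p_k - α q_k) + p_{k-1} - α q_{k-1}|` for `k ≥ 0`, `1 ≤ s ≤ a_{k+1}`. -/
def cfDelta (α : ℝ) (k s : ℕ) : ℝ :=
  |((s : ℝ) - 1) * (((cfPQ α (k + 1)).1 : ℝ) - α * ((cfPQ α (k + 1)).2 : ℝ)) +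
      (((cfPQ α k).1 : ℝ) - α * ((cfPQ α k).2 : ℝ))|

end
theorem twoIE_mem_Ico {α x : ℝ} (hα : α ∈ Set.Ioo (0:ℝ) 1) (hx : x ∈ Set.Ico (0:ℝ) 1) :
    twoIE α x ∈ Set.Ico (0:ℝ) 1 := by
  obtain ⟨h0, h1⟩ := hα
  obtain ⟨hx0, hx1⟩ := hx
  unfold twoIE
  split_ifs <;> constructor <;> linarith

theorem twoIE_iterate_mem_Ico {α x : ℝ} (hα : α ∈ Set.Ioo (0:ℝ) 1)
    (hx : x ∈ Set.Ico (0:ℝ) 1) (n : ℕ) : (twoIE α)^[n] x ∈ Set.Ico (0:ℝ) 1 := by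
  induction n with
  | zero => exact hx
  | succ n ih =>
    rw [Function.iterate_succ_apply']
    exact twoIE_mem_Ico hα ih

theorem twoIE_iterate_eq (α x : ℝ) (n : ℕ) :
    (twoIE α)^[n] x = x - n * α + (wordPrefix (sturmian α x) n).count false := by
  induction n with
  | zero => simp [wordPrefix, seg]
  | succ n ih =>
    have hcount : (wordPrefix (sturmian α x) (n + 1)).count false =
        (wordPrefix (sturmian α x) n).count false + if (twoIE α)^[n] x < α then 1 else 0 := by
      unfold wordPrefix seg
      rw [List.range_succ, List.map_append, List.count_append]
      by_cases h : (twoIE α)^[n] x < α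
      · simp [sturmian, h]
      · simp [sturmian, h, not_lt.mp h]
    rw [Function.iterate_succ_apply', hcount, twoIE]
    split_ifs <;> rw [ih] <;> push_cast <;> ring

/-- the prefix of length `n` of `u_{α,ρ}` is light
(number of 0's equal to `⌊nα⌋ + 1`) iff `ρ ∈ [0, frac(nα))`, and heavy
(number of 0's equal to `⌊nα⌋`) iff `ρ ∈ [frac(nα), 1)`. -/
theorem light_heavy_prefix_iff (α ρ : ℝ) (hα : α ∈ Set.Ioo (0:ℝ) 1)
    (hirr : Irrational α) (hρ : ρ ∈ Set.Ico (0:ℝ) 1) (n : ℕ) (hn : 1 ≤ n) :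
    ((wordPrefix (sturmian α ρ) n).count false = ⌊(n : ℝ) * α⌋₊ + 1 ↔
      ρ ∈ Set.Ico (0:ℝ) (Int.fract ((n : ℝ) * α))) ∧
    ((wordPrefix (sturmian α ρ) n).count false = ⌊(n : ℝ) * α⌋₊ ↔
      ρ ∈ Set.Ico (Int.fract ((n : ℝ) * α)) 1) := by
  obtain ⟨hlo, hhi⟩ := twoIE_iterate_mem_Ico hα hρ n
  rw [twoIE_iterate_eq] at hlo hhi
  generalize (wordPrefix (sturmian α ρ) n).count false = c at hlo hhi ⊢
  have hfloor : ((⌊(n : ℝ) * α⌋₊ : ℕ) : ℝ) + Int.fract ((n : ℝ) * α) = n * α := by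
    rw [natCast_floor_eq_intCast_floor (mul_nonneg n.cast_nonneg hα.1.le)]
    exact Int.floor_add_fract _
  have hf0 := Int.fract_nonneg ((n : ℝ) * α)
  have hf1 := Int.fract_lt_one ((n : ℝ) * α)
  obtain ⟨hρ0, hρ1⟩ := hρ
  generalize ⌊(n : ℝ) * α⌋₊ = m at hfloor ⊢
  generalize Int.fract ((n : ℝ) * α) = f at hfloor hf0 hf1 ⊢
  have hmc : m ≤ c := by
    have : (m : ℝ) < c + 1 := by linarith
    exact Nat.lt_succ_iff.mp (by exact_mod_cast this)
  have hcm : c ≤ m + 1 := by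
    have : (c : ℝ) < m + 1 + 1 := by linarith
    exact Nat.lt_succ_iff.mp (by exact_mod_cast this)
  obtain rfl | rfl : c = m ∨ c = m + 1 := by omega
  · have : f ≤ ρ := by linarith
    simp [this, hρ1]
  · have : ρ < f := by push_cast at hhi; linarith
    simp [this, hρ0]
end

section
/- Let α ∈ (0,1) be irrational. For any β₀ ∈ (0,1) there exists ε > 0 such that for every β ∈ (β₀ − ε, β₀ + ε) ∩ (0,1) one has S_{β₀} ⊆ S_β, where S_β denotes the set of all [0,β)-itineraries under T_α. -/
open Set

open Filter Topology

theorem twoIE_fract {α : ℝ} (hα : α ∈ Ioo (0:ℝ) 1) (y : ℝ) :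
    twoIE α (Int.fract y) = Int.fract (y - α) := by
  have h0 := Int.fract_nonneg y
  have h1 := Int.fract_lt_one y
  have hy := Int.floor_add_fract y
  obtain ⟨ha, hb⟩ := hα
  unfold twoIE
  split_ifs with h
  · symm
    rw [Int.fract_eq_iff]
    refine ⟨by linarith, by linarith, ⌊y⌋ - 1, ?_⟩
    push_cast
    linarith
  · symm
    rw [Int.fract_eq_iff]
    exact ⟨by linarith, by linarith, ⌊y⌋, by linarith⟩

theorem iterate_twoIE {α : ℝ} (hα : α ∈ Ioo (0:ℝ) 1) {x : ℝ} (hx : x ∈ Ico (0:ℝ) 1) (m : ℕ) :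
    (twoIE α)^[m] x = Int.fract (x - m * α) := by
  induction m with
  | zero => simpa using (Int.fract_eq_self.2 ⟨hx.1, hx.2⟩).symm
  | succ m ih =>
    rw [Function.iterate_succ_apply', ih, twoIE_fract hα]
    congr 1
    push_cast
    ring

theorem iterate_twoIE_nonneg {α : ℝ} (hα : α ∈ Ioo (0:ℝ) 1) {x : ℝ} (hx : x ∈ Ico (0:ℝ) 1)
    (m : ℕ) : 0 ≤ (twoIE α)^[m] x := by
  rw [iterate_twoIE hα hx]
  exact Int.fract_nonneg _

/-- An irrational rotation admits arbitrarily small nonzero translations among its powers. -/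
theorem exists_pos_mul_sub_small {α : ℝ} (hirr : Irrational α) {β : ℝ} (hβ : 0 < β) :
    ∃ (k : ℕ) (p : ℤ), 0 < k ∧ 0 < |p - k * α| ∧ |p - k * α| < β := by
  obtain ⟨n, hn⟩ := exists_nat_one_div_lt hβ
  obtain ⟨k, hk, -, hle⟩ := Real.exists_nat_abs_mul_sub_round_le α n.succ_pos
  refine ⟨k, round (k * α), hk, ?_, ?_⟩
  · rw [abs_pos, sub_ne_zero]
    intro h
    exact (hirr.natCast_mul hk.ne').ne_int _ h.symm
  · rw [abs_sub_comm]
    refine (hle.trans ?_).trans_lt hn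
    apply one_div_le_one_div_of_le <;> push_cast <;> linarith [n.cast_nonneg (α := ℝ)]

/-- Return times of an irrational rotation to `[0,β)` are uniformly bounded. -/
theorem exists_forall_exists_iterate_mem {α : ℝ} (hα : α ∈ Ioo (0:ℝ) 1) (hirr : Irrational α)
    {β : ℝ} (hβ : β ∈ Ioo (0:ℝ) 1) :
    ∃ N : ℕ, ∀ x ∈ Ico (0:ℝ) 1, ∃ m, 0 < m ∧ m ≤ N ∧ (twoIE α)^[m] x ∈ Ico (0:ℝ) β := by
  obtain ⟨k, p, hk, hpos, hlt⟩ := exists_pos_mul_sub_small hirr hβ.1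
  set d : ℝ := p - k * α with hd
  -- It suffices to land in `[c, c + β)` for some integer `c` by translating by `j * d`.
  suffices h : ∃ J : ℕ, ∀ x ∈ Ico (0:ℝ) 1, ∃ (j : ℕ) (c : ℤ), 0 < j ∧ j ≤ J ∧
      (c : ℝ) ≤ x + j * d ∧ x + j * d < c + β by
    obtain ⟨J, hJ⟩ := h
    refine ⟨k * J, fun x hx => ?_⟩
    obtain ⟨j, c, hj, hjJ, h1, h2⟩ := hJ x hx
    refine ⟨k * j, Nat.mul_pos hk hj, Nat.mul_le_mul_left k hjJ, ?_⟩
    have : Int.fract (x - (k * j : ℕ) * α) = x + j * d - c := by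
      rw [Int.fract_eq_iff]
      refine ⟨by linarith, by linarith [hβ.2], c - j * p, ?_⟩
      push_cast
      rw [hd]
      ring
    rw [iterate_twoIE hα hx, this]
    exact ⟨by linarith, by linarith⟩
  rcases lt_or_gt_of_ne (abs_pos.1 hpos) with hneg | hp
  · rw [abs_of_neg hneg] at hlt hpos
    refine ⟨⌊2 / -d⌋₊, fun x hx => ?_⟩
    have hq : 0 ≤ (x + 1) / -d := div_nonneg (by linarith [hx.1]) hpos.le
    refine ⟨⌊(x + 1) / -d⌋₊, -1, ?_, ?_, ?_, ?_⟩
    · rw [Nat.floor_pos, one_le_div hpos]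
      linarith [hx.1, hβ.2]
    · gcongr
      linarith [hx.2]
    · have := (le_div_iff₀ hpos).1 (Nat.floor_le hq)
      push_cast
      linarith
    · have := (div_lt_iff₀ hpos).1 (Nat.lt_floor_add_one ((x + 1) / -d))
      push_cast
      linarith
  · rw [abs_of_pos hp] at hlt
    refine ⟨⌈1 / d⌉₊, fun x hx => ?_⟩
    have hq : 0 < (1 - x) / d := div_pos (by linarith [hx.2]) hp
    refine ⟨⌈(1 - x) / d⌉₊, 1, Nat.ceil_pos.2 hq, ?_, ?_, ?_⟩
    · gcongr
      linarith [hx.1]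
    · have := (div_le_iff₀ hp).1 (Nat.le_ceil ((1 - x) / d))
      push_cast
      linarith
    · have h1 := Nat.ceil_lt_add_one hq.le
      have h2 := mul_lt_mul_of_pos_right h1 hp
      rw [add_mul, div_mul_cancel₀ _ hp.ne'] at h2
      push_cast
      linarith

/-- Iterates of `twoIE α` are local translations to the right of every point. -/
theorem eventually_iterate_twoIE_eq (α x : ℝ) (m : ℕ) :
    ∀ᶠ y in 𝓝[>] x, (twoIE α)^[m] y = (twoIE α)^[m] x + (y - x) := by
  induction m with
  | zero => simp
  | succ m ih =>
    by_cases hz : (twoIE α)^[m] x < α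
    · have hlt : ∀ᶠ y in 𝓝[>] x, y < x + (α - (twoIE α)^[m] x) :=
        eventually_nhdsWithin_of_eventually_nhds (eventually_lt_nhds (by linarith))
      filter_upwards [ih, hlt] with y hy hy'
      rw [Function.iterate_succ_apply', Function.iterate_succ_apply', hy, twoIE, twoIE,
        if_pos hz, if_pos (by linarith)]
      ring
    · filter_upwards [ih, self_mem_nhdsWithin] with y hy hy'
      have hxy : x < y := hy'
      rw [Function.iterate_succ_apply', Function.iterate_succ_apply', hy, twoIE, twoIE,
        if_neg hz, if_neg (by linarith)]
      ring

theorem eventually_iterate_twoIE_lt (α x c : ℝ) (m : ℕ) :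
    ∀ᶠ y in 𝓝[>] x, ((twoIE α)^[m] x < c ∧ (twoIE α)^[m] y < c) ∨
      (c ≤ (twoIE α)^[m] x ∧ c < (twoIE α)^[m] y) := by
  rcases lt_or_ge ((twoIE α)^[m] x) c with h | h
  · have hlt : ∀ᶠ y in 𝓝[>] x, y < x + (c - (twoIE α)^[m] x) :=
      eventually_nhdsWithin_of_eventually_nhds (eventually_lt_nhds (by linarith))
    filter_upwards [eventually_iterate_twoIE_eq α x m, hlt] with y hy hy'
    exact Or.inl ⟨h, by linarith⟩
  · filter_upwards [eventually_iterate_twoIE_eq α x m, self_mem_nhdsWithin] with y hy hy'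
    have hxy : x < y := hy'
    exact Or.inr ⟨h, by linarith⟩

theorem returnTime_congr {α x y : ℝ} {I J : Set ℝ}
    (hne : ∃ m, 0 < m ∧ (twoIE α)^[m] x ∈ I)
    (h : ∀ m ≤ returnTime α I x, ((twoIE α)^[m] y ∈ J ↔ (twoIE α)^[m] x ∈ I)) :
    returnTime α J y = returnTime α I x := by
  have hmem : 0 < returnTime α I x ∧ (twoIE α)^[returnTime α I x] x ∈ I := Nat.sInf_mem hne
  have hmemJ : 0 < returnTime α I x ∧ (twoIE α)^[returnTime α I x] y ∈ J :=
    ⟨hmem.1, (h _ le_rfl).2 hmem.2⟩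
  have hle : returnTime α J y ≤ returnTime α I x := Nat.sInf_le hmemJ
  have hmem' : 0 < returnTime α J y ∧ (twoIE α)^[returnTime α J y] y ∈ J :=
    Nat.sInf_mem (s := {m | 0 < m ∧ (twoIE α)^[m] y ∈ J}) ⟨_, hmemJ⟩
  exact hle.antisymm (Nat.sInf_le ⟨hmem'.1, (h _ hle).1 hmem'.2⟩)

theorem length_itin (α : ℝ) (I : Set ℝ) (x : ℝ) : (itin α I x).length = returnTime α I x := by
  simp [itin, wordPrefix, seg]

theorem Sitin_finite {α : ℝ} (hα : α ∈ Ioo (0:ℝ) 1) (hirr : Irrational α)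
    {β : ℝ} (hβ : β ∈ Ioo (0:ℝ) 1) : (Sitin α β).Finite := by
  obtain ⟨N, hN⟩ := exists_forall_exists_iterate_mem hα hirr hβ
  refine (List.finite_length_le Bool N).subset ?_
  rintro w ⟨x, hx, rfl⟩
  obtain ⟨m, hm, hmN, hmem⟩ := hN x ⟨hx.1, hx.2.trans hβ.2⟩
  rw [mem_ofPred_eq, length_itin]
  exact (Nat.sInf_le ⟨hm, hmem⟩ : returnTime α _ x ≤ m).trans hmN

theorem eventually_itin_mem_Sitin {α : ℝ} (hα : α ∈ Ioo (0:ℝ) 1) (hirr : Irrational α)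
    {β₀ : ℝ} (hβ₀ : β₀ ∈ Ioo (0:ℝ) 1) {x : ℝ} (hx : x ∈ Ico (0:ℝ) β₀) :
    ∀ᶠ β in 𝓝 β₀, itin α (Ico 0 β₀) x ∈ Sitin α β := by
  have hx1 : x ∈ Ico (0:ℝ) 1 := ⟨hx.1, hx.2.trans hβ₀.2⟩
  have hne : ∃ m, 0 < m ∧ (twoIE α)^[m] x ∈ Ico (0:ℝ) β₀ := by
    obtain ⟨N, hN⟩ := exists_forall_exists_iterate_mem hα hirr hβ₀
    obtain ⟨m, hm, -, hmem⟩ := hN x hx1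
    exact ⟨m, hm, hmem⟩
  set r := returnTime α (Ico 0 β₀) x with hr
  have hβev : ∀ᶠ y in 𝓝[>] x, ∀ m ∈ Iic r, ((twoIE α)^[m] x < β₀ ∧ (twoIE α)^[m] y < β₀) ∨
      (β₀ ≤ (twoIE α)^[m] x ∧ β₀ < (twoIE α)^[m] y) :=
    (eventually_all_finite (finite_Iic r)).2 fun m _ => eventually_iterate_twoIE_lt α x β₀ m
  have hαev : ∀ᶠ y in 𝓝[>] x, ∀ m ∈ Iic r, ((twoIE α)^[m] x < α ∧ (twoIE α)^[m] y < α) ∨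
      (α ≤ (twoIE α)^[m] x ∧ α < (twoIE α)^[m] y) :=
    (eventually_all_finite (finite_Iic r)).2 fun m _ => eventually_iterate_twoIE_lt α x α m
  have hlt : ∀ᶠ y in 𝓝[>] x, y < β₀ :=
    eventually_nhdsWithin_of_eventually_nhds (eventually_lt_nhds hx.2)
  obtain ⟨y, hyβ, hyα, hylt, hxy⟩ :=
    (hβev.and (hαev.and (hlt.and self_mem_nhdsWithin))).exists
  have hy0 : 0 ≤ y := hx.1.trans (le_of_lt hxy)
  have hy1 : y ∈ Ico (0:ℝ) 1 := ⟨hy0, hylt.trans hβ₀.2⟩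
  have hev : ∀ᶠ β in 𝓝 β₀, ∀ m ∈ Iic r, ((twoIE α)^[m] y < β ↔ (twoIE α)^[m] x < β₀) := by
    refine (eventually_all_finite (finite_Iic r)).2 fun m hm => ?_
    rcases hyβ m hm with ⟨h1, h2⟩ | ⟨h1, h2⟩
    · filter_upwards [eventually_gt_nhds h2] with β hβ
      exact iff_of_true hβ h1
    · filter_upwards [eventually_lt_nhds h2] with β hβ
      exact iff_of_false hβ.le.not_gt h1.not_gt
  filter_upwards [hev, eventually_gt_nhds hylt] with β hβ hyβ'
  refine ⟨y, ⟨hy0, hyβ'⟩, ?_⟩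
  have hrt : returnTime α (Ico 0 β) y = r := by
    refine returnTime_congr hne fun m hm => ?_
    simp only [mem_Ico, iterate_twoIE_nonneg hα hx1, iterate_twoIE_nonneg hα hy1, true_and]
    exact hβ m hm
  rw [itin, itin, hrt, ← hr, wordPrefix, wordPrefix, seg, seg]
  refine List.map_congr_left fun j hj => ?_
  have hjr : j ∈ Iic r := (List.mem_range.1 hj).le
  rw [zero_add, sturmian, sturmian]
  rcases hyα j hjr with ⟨h1, h2⟩ | ⟨h1, h2⟩
  · rw [if_neg h1.not_ge, if_neg h2.not_ge]
  · rw [if_pos h1, if_pos h2.le]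

/-- for every `β₀ ∈ (0,1)` there is `ε > 0` such that `S_{β₀} ⊆ S_β`
for every `β ∈ (β₀ - ε, β₀ + ε) ∩ (0,1)`. -/
theorem Sitin_subset_near (α : ℝ) (hα : α ∈ Set.Ioo (0:ℝ) 1) (hirr : Irrational α)
    (β₀ : ℝ) (hβ₀ : β₀ ∈ Set.Ioo (0:ℝ) 1) :
    ∃ ε > (0:ℝ), ∀ β ∈ Set.Ioo (β₀ - ε) (β₀ + ε) ∩ Set.Ioo (0:ℝ) 1,
      Sitin α β₀ ⊆ Sitin α β := by
  have hev : ∀ᶠ β in 𝓝 β₀, ∀ w ∈ Sitin α β₀, w ∈ Sitin α β := by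
    refine (eventually_all_finite (Sitin_finite hα hirr hβ₀)).2 ?_
    rintro w ⟨x, hx, rfl⟩
    exact eventually_itin_mem_Sitin hα hirr hβ₀ hx
  obtain ⟨ε, hε, h⟩ := Metric.eventually_nhds_iff.1 hev
  refine ⟨ε, hε, fun β hβ w hw => h ?_ w hw⟩
  rw [Real.dist_eq, abs_lt]
  exact ⟨by linarith [hβ.1.1], by linarith [hβ.1.2]⟩
end

section
/- Let α ∈ (0,1) be irrational and let I = [c, c+δ) with 0 ≤ c < c+δ ≤ 1. Let T_I : I → I be the first return map T_I(x) = T_α^{r_I(x)}(x). Then the set of translation values { T_I(x) − x : x ∈ I } has exactly two elements if δ = δ_{k,s} for some k ≥ 0 and 1 ≤ s ≤ a_{k+1}, and exactly three elements otherwise. -/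
open Set

/-- On `[0,1)` the exchange of two intervals is the rotation by `-α`. -/
theorem twoIE_iterate_eq_fract {α : ℝ} (hα : α ∈ Set.Ioo (0:ℝ) 1) {x : ℝ}
    (hx : x ∈ Set.Ico (0:ℝ) 1) (n : ℕ) : (twoIE α)^[n] x = Int.fract (x - n * α) := by
  induction n with
  | zero => simpa using (Int.fract_eq_self.mpr hx).symm
  | succ n ih =>
    rw [Function.iterate_succ_apply', ih]
    have h0 := Int.fract_nonneg (x - n * α)
    have h1 := Int.fract_lt_one (x - n * α)
    have h2 := Int.floor_add_fract (x - n * α)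
    obtain ⟨hα0, hα1⟩ := hα
    symm
    rw [Int.fract_eq_iff]
    unfold twoIE
    split_ifs with h
    · refine ⟨by linarith, by linarith, ⌊x - n * α⌋ - 1, ?_⟩
      push_cast
      linarith
    · refine ⟨by linarith, by linarith, ⌊x - n * α⌋, ?_⟩
      push_cast
      linarith

theorem twoIE_iterate_eq_iff {α : ℝ} (hα : α ∈ Set.Ioo (0:ℝ) 1) {x y : ℝ}
    (hx : x ∈ Set.Ico (0:ℝ) 1) (hy : y ∈ Set.Ico (0:ℝ) 1) (n : ℕ) :
    (twoIE α)^[n] x = y ↔ ∃ r : ℤ, y = x + (r - n * α) := by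
  rw [twoIE_iterate_eq_fract hα hx, Int.fract_eq_iff]
  constructor
  · rintro ⟨-, -, z, hz⟩
    refine ⟨-z, ?_⟩
    push_cast
    linarith
  · rintro ⟨r, hr⟩
    refine ⟨hy.1, hy.2, -r, ?_⟩
    push_cast
    linarith

/-- If `x + (P - N α)` lies in `I` and no smaller positive time admits a return to `I`, then
the induced map translates `x` by `P - N α`. -/
theorem induced_translation_eq {α : ℝ} (hα : α ∈ Set.Ioo (0:ℝ) 1) {I : Set ℝ}
    (hI : I ⊆ Set.Ico 0 1) {x : ℝ} (hx : x ∈ I) {N : ℕ} (hN : 0 < N) {P : ℤ}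
    (hmem : x + (P - N * α) ∈ I)
    (hmin : ∀ n : ℕ, 0 < n → ∀ r : ℤ, x + (r - n * α) ∈ I → N ≤ n) :
    (twoIE α)^[returnTime α I x] x - x = P - N * α := by
  have hT : (twoIE α)^[N] x = x + (P - N * α) :=
    (twoIE_iterate_eq_iff hα (hI hx) (hI hmem) N).mpr ⟨P, rfl⟩
  have hN' : N ∈ {m : ℕ | 0 < m ∧ (twoIE α)^[m] x ∈ I} := ⟨hN, by rw [hT]; exact hmem⟩
  have hret : returnTime α I x = N := by
    refine le_antisymm (Nat.sInf_le hN') ?_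
    obtain ⟨h0, h1⟩ := Nat.sInf_mem ⟨N, hN'⟩
    obtain ⟨r, hr⟩ := (twoIE_iterate_eq_iff hα (hI hx) (hI h1) _).mp rfl
    exact hmin _ h0 r (hr ▸ h1)
  rw [hret, hT]
  ring

/-- Return vectors to an interval of length `δ ≤ u + v`, in coordinates with respect to a
unimodular basis whose displacements are `u > 0` and `-v < 0`. -/
theorem return_coordinates {α δ u v : ℝ} {M M' P P' : ℤ} (hM : 1 ≤ M) (hM' : 1 ≤ M')
    (hdet : P * M' - P' * M = 1) (hu : u = P - M * α) (hv : v = M' * α - P') (hu0 : 0 < u)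
    (hv0 : 0 < v) (hδ : δ ≤ u + v) {n r : ℤ} (hn : 0 < n)
    (h1 : -δ < r - n * α) (h2 : r - n * α < δ) :
    ∃ i j : ℤ, 0 ≤ i ∧ 0 ≤ j ∧ 0 < i + j ∧ n = i * M + j * M' ∧
      (r : ℝ) - n * α = i * u - j * v := by
  have hn' : n = (r * M' - n * P') * M + (n * P - r * M) * M' := by
    linear_combination -n * hdet
  have hr' : r = (r * M' - n * P') * P + (n * P - r * M) * P' := by
    linear_combination -r * hdet
  generalize r * M' - n * P' = i at hn' hr'
  generalize n * P - r * M = j at hn' hr'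
  have hd : (r : ℝ) - n * α = i * u - j * v := by
    rw [hn', hr', hu, hv]
    push_cast
    ring
  rw [hd] at h1 h2
  have hi : 0 ≤ i := by
    by_contra! hi
    by_cases hj : j ≤ 0
    · nlinarith
    · have hi' : (i : ℝ) ≤ -1 := by exact_mod_cast (by lia : i ≤ -1)
      have hj' : (1 : ℝ) ≤ j := by exact_mod_cast (by lia : 1 ≤ j)
      nlinarith
  have hj : 0 ≤ j := by
    by_contra! hj
    by_cases hi0 : i ≤ 0
    · nlinarith
    · have hj' : (j : ℝ) ≤ -1 := by exact_mod_cast (by lia : j ≤ -1)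
      have hi' : (1 : ℝ) ≤ i := by exact_mod_cast (by lia : 1 ≤ i)
      nlinarith
  refine ⟨i, j, hi, hj, ?_, hn', hd⟩
  by_contra! h
  have hi0 : i = 0 := by lia
  have hj0 : j = 0 := by lia
  subst hi0 hj0
  simp at hn'
  lia

/-- The induced map on `[c, c + δ)` described by a unimodular basis of return vectors with
displacements `u` and `-v`, where `max u v < δ ≤ u + v`. -/
theorem induced_translation_of_basis {α c δ u v : ℝ} (hα : α ∈ Set.Ioo (0:ℝ) 1) (hc : 0 ≤ c)
    (hcδ : c + δ ≤ 1) {M M' P P' : ℤ} (hM : 1 ≤ M) (hM' : 1 ≤ M')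
    (hdet : P * M' - P' * M = 1) (hu : u = P - M * α) (hv : v = M' * α - P') (hu0 : 0 < u)
    (hv0 : 0 < v) (huδ : u < δ) (hvδ : v < δ) (hδ : δ ≤ u + v) {x : ℝ}
    (hx : x ∈ Set.Ico c (c + δ)) :
    (twoIE α)^[returnTime α (Set.Ico c (c + δ)) x] x - x =
      if x < c + δ - u then u else if c + v ≤ x then -v else u - v := by
  have hI : Set.Ico c (c + δ) ⊆ Set.Ico 0 1 := Set.Ico_subset_Ico hc hcδ
  have key : ∀ n : ℕ, 0 < n → ∀ r : ℤ, x + (r - n * α) ∈ Set.Ico c (c + δ) →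
      ∃ i j : ℤ, 0 ≤ i ∧ 0 ≤ j ∧ 0 < i + j ∧ (n : ℤ) = i * M + j * M' ∧
        x + (i * u - j * v) ∈ Set.Ico c (c + δ) := by
    intro n hn r hr
    obtain ⟨i, j, hi, hj, hij, h, hd⟩ := return_coordinates (n := n) (r := r) hM hM' hdet hu hv
      hu0 hv0 hδ (by exact_mod_cast hn)
      (by push_cast; linarith [hr.1, hx.2]) (by push_cast; linarith [hr.2, hx.1])
    push_cast at hd
    exact ⟨i, j, hi, hj, hij, h, hd ▸ hr⟩
  lift M to ℕ using by lia
  lift M' to ℕ using by lia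
  push_cast at hu hv
  obtain ⟨hx1, hx2⟩ := hx
  split_ifs with h1 h2
  · rw [hu]
    refine induced_translation_eq hα hI ⟨hx1, hx2⟩ (by lia) (P := P) (N := M) ?_ ?_
    · rw [← hu]
      constructor <;> linarith
    · intro n hn r hr
      obtain ⟨i, j, hi, hj, hij, h, hd1, hd2⟩ := key n hn r hr
      by_cases hi0 : i = 0
      · subst hi0
        have hj' : (1 : ℝ) ≤ j := by exact_mod_cast (by lia : 1 ≤ j)
        push_cast at hd1
        nlinarith
      · have : 1 ≤ i := by lia
        zify
        nlinarith
  · have hv' : -v = P' - M' * α := by rw [hv]; ring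
    rw [hv']
    refine induced_translation_eq hα hI ⟨hx1, hx2⟩ (by lia) (P := P') (N := M') ?_ ?_
    · rw [← hv']
      constructor <;> linarith
    · intro n hn r hr
      obtain ⟨i, j, hi, hj, hij, h, hd1, hd2⟩ := key n hn r hr
      by_cases hj0 : j = 0
      · subst hj0
        have hi' : (1 : ℝ) ≤ i := by exact_mod_cast (by lia : 1 ≤ i)
        push_cast at hd2
        nlinarith
      · have : 1 ≤ j := by lia
        zify
        nlinarith
  · have huv : u - v = ((P + P' : ℤ) : ℝ) - ((M + M' : ℕ) : ℝ) * α := by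
      rw [hu, hv]
      push_cast
      ring
    rw [huv]
    refine induced_translation_eq hα hI ⟨hx1, hx2⟩ (by lia) ?_ ?_
    · rw [← huv]
      constructor <;> linarith
    · intro n hn r hr
      obtain ⟨i, j, hi, hj, hij, h, hd1, hd2⟩ := key n hn r hr
      have hi1 : 1 ≤ i := by
        by_contra! hi'
        have hi0 : i = 0 := by lia
        subst hi0
        have hj' : (1 : ℝ) ≤ j := by exact_mod_cast (by lia : 1 ≤ j)
        push_cast at hd1
        nlinarith
      have hj1 : 1 ≤ j := by
        by_contra! hj'
        have hj0 : j = 0 := by lia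
        subst hj0
        have hi' : (1 : ℝ) ≤ i := by exact_mod_cast (by lia : 1 ≤ i)
        push_cast at hd2
        nlinarith
      zify
      nlinarith

theorem induced_ncard_of_basis {α c δ u v : ℝ} (hα : α ∈ Set.Ioo (0:ℝ) 1) (hc : 0 ≤ c)
    (hcδ : c + δ ≤ 1) {M M' P P' : ℤ} (hM : 1 ≤ M) (hM' : 1 ≤ M')
    (hdet : P * M' - P' * M = 1) (hu : u = P - M * α) (hv : v = M' * α - P') (hu0 : 0 < u)
    (hv0 : 0 < v) (huδ : u < δ) (hvδ : v < δ) (hδ : δ ≤ u + v) :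
    {t : ℝ | ∃ x ∈ Set.Ico c (c + δ),
        (twoIE α)^[returnTime α (Set.Ico c (c + δ)) x] x - x = t}.ncard =
      if δ = u + v then 2 else 3 := by
  have key : ∀ x ∈ Set.Ico c (c + δ), (twoIE α)^[returnTime α (Set.Ico c (c + δ)) x] x - x =
      if x < c + δ - u then u else if c + v ≤ x then -v else u - v := fun x hx =>
    induced_translation_of_basis hα hc hcδ hM hM' hdet hu hv hu0 hv0 huδ hvδ hδ hx
  split_ifs with h
  · have : {t : ℝ | ∃ x ∈ Set.Ico c (c + δ),
        (twoIE α)^[returnTime α (Set.Ico c (c + δ)) x] x - x = t} = {u, -v} := by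
      ext t
      simp only [Set.mem_ofPred_eq, Set.mem_insert_iff, Set.mem_singleton_iff]
      constructor
      · rintro ⟨x, hx, rfl⟩
        rw [key x hx]
        split_ifs with h1 h2
        · exact Or.inl rfl
        · exact Or.inr rfl
        · exact absurd (by linarith) h2
      · rintro (rfl | rfl)
        · refine ⟨c, ⟨le_rfl, by linarith⟩, ?_⟩
          rw [key c ⟨le_rfl, by linarith⟩, if_pos (by linarith)]
        · refine ⟨c + v, ⟨by linarith, by linarith⟩, ?_⟩
          rw [key _ ⟨by linarith, by linarith⟩, if_neg (by linarith), if_pos le_rfl]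
    rw [this]
    exact Set.ncard_pair (by linarith)
  · have hlt : δ < u + v := lt_of_le_of_ne hδ h
    have : {t : ℝ | ∃ x ∈ Set.Ico c (c + δ),
        (twoIE α)^[returnTime α (Set.Ico c (c + δ)) x] x - x = t} = {u, -v, u - v} := by
      ext t
      simp only [Set.mem_ofPred_eq, Set.mem_insert_iff, Set.mem_singleton_iff]
      constructor
      · rintro ⟨x, hx, rfl⟩
        rw [key x hx]
        split_ifs <;> simp
      · rintro (rfl | rfl | rfl)
        · refine ⟨c, ⟨le_rfl, by linarith⟩, ?_⟩
          rw [key c ⟨le_rfl, by linarith⟩, if_pos (by linarith)]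
        · refine ⟨c + v, ⟨by linarith, by linarith⟩, ?_⟩
          rw [key _ ⟨by linarith, by linarith⟩, if_neg (by linarith), if_pos le_rfl]
        · refine ⟨c + δ - u, ⟨by linarith, by linarith⟩, ?_⟩
          rw [key _ ⟨by linarith, by linarith⟩, if_neg (by linarith), if_neg (by linarith)]
    rw [this]
    exact Set.ncard_eq_three.mpr ⟨u, -v, u - v, by intro h; linarith, by intro h; linarith,
      by intro h; linarith, rfl⟩

/-- The signed error `p_{k-1} - α q_{k-1}` of the convergent stored in `cfPQ α k`. -/
noncomputable def cfErr (α : ℝ) (k : ℕ) : ℝ := ((cfPQ α k).1 : ℝ) - α * ((cfPQ α k).2 : ℝ)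

theorem cfDelta_eq (α : ℝ) (k s : ℕ) :
    cfDelta α k s = |((s : ℝ) - 1) * cfErr α (k + 1) + cfErr α k| := rfl

theorem cfErr_add_two (α : ℝ) (k : ℕ) :
    cfErr α (k + 2) = cfa α (k + 1) * cfErr α (k + 1) + cfErr α k := by
  simp only [cfErr, cfPQ]
  push_cast
  ring

theorem gaussMap_iterate_mem {α : ℝ} (hα : α ∈ Set.Ioo (0:ℝ) 1) (hirr : Irrational α) (k : ℕ) :
    gaussMap^[k] α ∈ Set.Ioo (0:ℝ) 1 ∧ Irrational (gaussMap^[k] α) := by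
  induction k with
  | zero => exact ⟨hα, hirr⟩
  | succ k ih =>
    rw [Function.iterate_succ_apply']
    have hi : Irrational (gaussMap (gaussMap^[k] α)) := by
      unfold gaussMap Int.fract
      exact ih.2.inv.sub_intCast _
    refine ⟨⟨lt_of_le_of_ne (Int.fract_nonneg _) ?_, Int.fract_lt_one _⟩, hi⟩
    exact hi.ne_zero.symm

theorem cfErr_succ {α : ℝ} (hα : α ∈ Set.Ioo (0:ℝ) 1) (hirr : Irrational α) (k : ℕ) :
    cfErr α (k + 1) = -(gaussMap^[k] α) * cfErr α k := by
  induction k with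
  | zero => simp [cfErr, cfPQ]
  | succ k ih =>
    obtain ⟨⟨h0, -⟩, -⟩ := gaussMap_iterate_mem hα hirr k
    rw [cfErr_add_two, Function.iterate_succ_apply']
    have ha : (cfa α (k + 1) : ℝ) = (gaussMap^[k] α)⁻¹ - gaussMap (gaussMap^[k] α) := by
      have h : (0 : ℝ) ≤ (gaussMap^[k] α)⁻¹ := by positivity
      rw [cfa, Nat.add_sub_cancel, gaussMap, Int.self_sub_fract, natCast_floor_eq_intCast_floor h]
    rw [ha, ih]
    field_simp
    ring

theorem one_le_cfa {α : ℝ} (hα : α ∈ Set.Ioo (0:ℝ) 1) (hirr : Irrational α) (k : ℕ) :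
    1 ≤ cfa α (k + 1) := by
  obtain ⟨⟨h0, h1⟩, -⟩ := gaussMap_iterate_mem hα hirr k
  rw [cfa, Nat.add_sub_cancel]
  exact Nat.le_floor (by simpa using (one_lt_inv₀ h0).mpr h1 |>.le)

/-- Signs of consecutive errors, and the determinant of consecutive convergents. -/
theorem cfErr_sign_det {α : ℝ} (hα : α ∈ Set.Ioo (0:ℝ) 1) (hirr : Irrational α) (k : ℕ) :
    (0 < cfErr α k ∧ cfErr α (k + 1) < 0 ∧
      (cfPQ α k).1 * (cfPQ α (k + 1)).2 - (cfPQ α (k + 1)).1 * (cfPQ α k).2 = 1) ∨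
    (cfErr α k < 0 ∧ 0 < cfErr α (k + 1) ∧
      (cfPQ α (k + 1)).1 * (cfPQ α k).2 - (cfPQ α k).1 * (cfPQ α (k + 1)).2 = 1) := by
  induction k with
  | zero => left; simpa [cfErr, cfPQ] using hα.1
  | succ k ih =>
    obtain ⟨⟨h0, -⟩, -⟩ := gaussMap_iterate_mem hα hirr (k + 1)
    have hs := cfErr_succ hα hirr (k + 1)
    rcases ih with ⟨-, h, hdet⟩ | ⟨-, h, hdet⟩
    · right
      refine ⟨h, by nlinarith, ?_⟩
      simp only [cfPQ]
      linear_combination hdet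
    · left
      refine ⟨h, by nlinarith, ?_⟩
      simp only [cfPQ]
      linear_combination hdet

theorem cfPQ_snd_bounds {α : ℝ} (hα : α ∈ Set.Ioo (0:ℝ) 1) (hirr : Irrational α) (k : ℕ) :
    0 ≤ (cfPQ α k).2 ∧ 1 ≤ (cfPQ α (k + 1)).2 := by
  induction k with
  | zero => simp [cfPQ]
  | succ k ih =>
    refine ⟨by linarith [ih.2], ?_⟩
    have ha : (1 : ℤ) ≤ cfa α (k + 1) := by exact_mod_cast one_le_cfa hα hirr k
    simp only [cfPQ]
    nlinarith [ih.1, ih.2]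

theorem abs_cfErr_pos {α : ℝ} (hα : α ∈ Set.Ioo (0:ℝ) 1) (hirr : Irrational α) (k : ℕ) :
    0 < |cfErr α k| := by
  rcases cfErr_sign_det hα hirr k with h | h
  · exact abs_pos.mpr h.1.ne'
  · exact abs_pos.mpr h.1.ne

theorem abs_cfErr_succ_lt {α : ℝ} (hα : α ∈ Set.Ioo (0:ℝ) 1) (hirr : Irrational α) (k : ℕ) :
    |cfErr α (k + 1)| < |cfErr α k| := by
  obtain ⟨⟨h0, h1⟩, -⟩ := gaussMap_iterate_mem hα hirr k
  rw [cfErr_succ hα hirr, abs_mul, abs_neg, abs_of_pos h0]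
  nlinarith [abs_cfErr_pos hα hirr k]

theorem abs_cfErr_add_two {α : ℝ} (hα : α ∈ Set.Ioo (0:ℝ) 1) (hirr : Irrational α) (k : ℕ) :
    |cfErr α (k + 2)| = |cfErr α k| - cfa α (k + 1) * |cfErr α (k + 1)| := by
  have h := cfErr_add_two α k
  rcases cfErr_sign_det hα hirr k with ⟨h1, h2, -⟩ | ⟨h1, h2, -⟩ <;>
  rcases cfErr_sign_det hα hirr (k + 1) with ⟨h3, h4, -⟩ | ⟨h3, h4, -⟩
  · linarith
  · rw [abs_of_pos h1, abs_of_neg h2, abs_of_pos h4, h]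
    ring
  · rw [abs_of_neg h1, abs_of_pos h2, abs_of_neg h4, h]
    ring
  · linarith

theorem exists_abs_cfErr_lt {α : ℝ} (hα : α ∈ Set.Ioo (0:ℝ) 1) (hirr : Irrational α) {δ : ℝ}
    (hδ : 0 < δ) : ∃ k, |cfErr α k| < δ := by
  have h : ∀ k, |cfErr α (2 * k)| ≤ (1 / 2 : ℝ) ^ k := by
    intro k
    induction k with
    | zero => simp [cfErr, cfPQ]
    | succ k ih =>
      have ha : (1 : ℝ) ≤ cfa α (2 * k + 1) := by exact_mod_cast one_le_cfa hα hirr (2 * k)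
      have h1 := abs_cfErr_add_two hα hirr (2 * k)
      have h2 := abs_cfErr_succ_lt hα hirr (2 * k + 1)
      have h3 := abs_cfErr_pos hα hirr (2 * k + 1)
      rw [pow_succ, show 2 * (k + 1) = 2 * k + 2 by ring]
      rw [show 2 * k + 1 + 1 = 2 * k + 2 by ring] at h2
      nlinarith
  obtain ⟨k, hk⟩ := exists_pow_lt_of_lt_one hδ (by norm_num : (1 / 2 : ℝ) < 1)
  exact ⟨2 * k, (h k).trans_lt hk⟩

theorem cfDelta_eq_sub {α : ℝ} (hα : α ∈ Set.Ioo (0:ℝ) 1) (hirr : Irrational α) {k s : ℕ}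
    (hs : s ≤ cfa α (k + 1)) :
    cfDelta α k s = |cfErr α k| - ((s : ℝ) - 1) * |cfErr α (k + 1)| := by
  have h2 := abs_cfErr_pos hα hirr (k + 2)
  rw [abs_cfErr_add_two hα hirr] at h2
  have h3 := abs_cfErr_pos hα hirr (k + 1)
  have hs' : (s : ℝ) ≤ cfa α (k + 1) := by exact_mod_cast hs
  rw [cfDelta_eq]
  rcases cfErr_sign_det hα hirr k with ⟨h4, h5, -⟩ | ⟨h4, h5, -⟩
  · rw [abs_of_pos h4, abs_of_neg h5] at *
    rw [abs_of_pos (by nlinarith)]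
    ring
  · rw [abs_of_neg h4, abs_of_pos h5] at *
    rw [abs_of_neg (by nlinarith)]
    ring

/-- The number of translation values when `δ` lies between `δ_{k,s}` and its successor. -/
theorem induced_ncard_of_cfDelta {α c δ : ℝ} (hα : α ∈ Set.Ioo (0:ℝ) 1) (hirr : Irrational α)
    (hc : 0 ≤ c) (hcδ : c + δ ≤ 1) {k s : ℕ} (hs1 : 1 ≤ s) (hs : s ≤ cfa α (k + 1))
    (h1 : |cfErr α (k + 1)| < δ) (h2 : |cfErr α k| - s * |cfErr α (k + 1)| < δ)
    (h3 : δ ≤ cfDelta α k s) :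
    {t : ℝ | ∃ x ∈ Set.Ico c (c + δ),
        (twoIE α)^[returnTime α (Set.Ico c (c + δ)) x] x - x = t}.ncard =
      if δ = cfDelta α k s then 2 else 3 := by
  rw [cfDelta_eq_sub hα hirr hs] at h3 ⊢
  have h4 := abs_cfErr_pos hα hirr (k + 2)
  rw [abs_cfErr_add_two hα hirr] at h4
  have hs' : (s : ℝ) ≤ cfa α (k + 1) := by exact_mod_cast hs
  have h5 := abs_cfErr_pos hα hirr (k + 1)
  have h6 : 0 < |cfErr α k| - s * |cfErr α (k + 1)| := by nlinarith
  obtain ⟨hQ, hQ'⟩ := cfPQ_snd_bounds hα hirr k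
  have hM : 1 ≤ (cfPQ α k).2 + s * (cfPQ α (k + 1)).2 := by
    have : (1 : ℤ) ≤ s := by exact_mod_cast hs1
    nlinarith
  rcases cfErr_sign_det hα hirr k with ⟨h7, h8, hdet⟩ | ⟨h7, h8, hdet⟩
  · have h := induced_ncard_of_basis (u := |cfErr α k| - s * |cfErr α (k + 1)|)
      (v := |cfErr α (k + 1)|) (P := (cfPQ α k).1 + s * (cfPQ α (k + 1)).1)
      (P' := (cfPQ α (k + 1)).1) hα hc hcδ hM hQ' (by linear_combination hdet)
      (by rw [abs_of_pos h7, abs_of_neg h8]; simp only [cfErr]; push_cast; ring)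
      (by rw [abs_of_neg h8]; simp only [cfErr]; ring) h6 h5 h2 h1 (by linarith)
    rw [h]
    congr 2
    ring
  · have h := induced_ncard_of_basis (v := |cfErr α k| - s * |cfErr α (k + 1)|)
      (u := |cfErr α (k + 1)|) (P' := (cfPQ α k).1 + s * (cfPQ α (k + 1)).1)
      (P := (cfPQ α (k + 1)).1) hα hc hcδ hQ' hM (by linear_combination hdet)
      (by rw [abs_of_pos h8]; simp only [cfErr]; ring)
      (by rw [abs_of_neg h7, abs_of_pos h8]; simp only [cfErr]; push_cast; ring)
      h5 h6 h1 h2 (by linarith)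
    rw [h]
    congr 2
    ring

theorem exists_cfDelta_bracket {α δ : ℝ} (hα : α ∈ Set.Ioo (0:ℝ) 1) (hirr : Irrational α)
    (hδ : 0 < δ) (hδ1 : δ ≤ 1) :
    ∃ k s : ℕ, 1 ≤ s ∧ s ≤ cfa α (k + 1) ∧ |cfErr α (k + 1)| < δ ∧
      |cfErr α k| - s * |cfErr α (k + 1)| < δ ∧ δ ≤ cfDelta α k s := by
  classical
  obtain ⟨k, hk, hk'⟩ : ∃ k, |cfErr α (k + 1)| < δ ∧ δ ≤ |cfErr α k| := by
    have hex := exists_abs_cfErr_lt hα hirr hδ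
    obtain ⟨k, hk⟩ := Nat.exists_eq_succ_of_ne_zero (n := Nat.find hex) (by
      intro h0
      have h := Nat.find_spec hex
      rw [h0] at h
      simp [cfErr, cfPQ] at h
      linarith)
    refine ⟨k, ?_, not_lt.mp (Nat.find_min hex (by lia))⟩
    have h := Nat.find_spec hex
    rwa [hk] at h
  have hlast : |cfErr α k| - cfa α (k + 1) * |cfErr α (k + 1)| < δ := by
    rw [← abs_cfErr_add_two hα hirr]
    exact (abs_cfErr_succ_lt hα hirr (k + 1)).trans hk
  have hex : ∃ s : ℕ, |cfErr α k| - s * |cfErr α (k + 1)| < δ := ⟨_, hlast⟩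
  obtain ⟨s, hs⟩ := Nat.exists_eq_succ_of_ne_zero (n := Nat.find hex) (by
    intro h0
    have h := Nat.find_spec hex
    rw [h0] at h
    push_cast at h
    linarith)
  have hle : s + 1 ≤ cfa α (k + 1) := by
    rw [← Nat.succ_eq_add_one, ← hs]
    exact Nat.find_min' hex hlast
  refine ⟨k, s + 1, by lia, hle, hk, ?_, ?_⟩
  · have h := Nat.find_spec hex
    rwa [hs] at h
  · rw [cfDelta_eq_sub hα hirr hle]
    have h := not_lt.mp (Nat.find_min hex (show s < Nat.find hex by lia))
    push_cast
    linarith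

/-- for `I = [c, c+δ) ⊆ [0,1)`, the first return map `T_I` is an
exchange of two intervals (two translation values) if `δ = δ_{k,s}` for some
`k ≥ 0`, `1 ≤ s ≤ a_{k+1}`, and an exchange of three intervals (three translation
values) otherwise. -/
theorem induced_map_two_or_three (α : ℝ) (hα : α ∈ Set.Ioo (0:ℝ) 1)
    (hirr : Irrational α) (c δ : ℝ) (hc : 0 ≤ c) (hδ : 0 < δ) (h1 : c + δ ≤ 1) :
    ((∃ k s : ℕ, 1 ≤ s ∧ s ≤ cfa α (k + 1) ∧ δ = cfDelta α k s) →
      {t : ℝ | ∃ x ∈ Set.Ico c (c + δ),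
        (twoIE α)^[returnTime α (Set.Ico c (c + δ)) x] x - x = t}.ncard = 2) ∧
    ((¬ ∃ k s : ℕ, 1 ≤ s ∧ s ≤ cfa α (k + 1) ∧ δ = cfDelta α k s) →
      {t : ℝ | ∃ x ∈ Set.Ico c (c + δ),
        (twoIE α)^[returnTime α (Set.Ico c (c + δ)) x] x - x = t}.ncard = 3) := by
  constructor
  · rintro ⟨k, s, hs1, hs, rfl⟩
    have h4 := abs_cfErr_pos hα hirr (k + 2)
    rw [abs_cfErr_add_two hα hirr] at h4
    have hs' : (s : ℝ) ≤ cfa α (k + 1) := by exact_mod_cast hs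
    have h5 := abs_cfErr_pos hα hirr (k + 1)
    have h6 := cfDelta_eq_sub hα hirr hs
    rw [induced_ncard_of_cfDelta hα hirr hc h1 hs1 hs (by nlinarith) (by linarith) le_rfl,
      if_pos rfl]
  · intro hne
    obtain ⟨k, s, hs1, hs, h2, h3, h4⟩ := exists_cfDelta_bracket hα hirr hδ (by linarith)
    rw [induced_ncard_of_cfDelta hα hirr hc h1 hs1 hs h2 h3 h4,
      if_neg fun h => hne ⟨k, s, hs1, hs, h⟩]
end

section
/- Let α ∈ (0,1) be irrational and let 0 < β ≤ 1. Then for the interval I = [0,β) there exist finite binary words R and R' with R ≺_lex R' such that the I-itinerary R_I(x) of every x ∈ I under T_α satisfies R_I(x) ∈ {R, R', RR'} (where RR' denotes the concatenation of R and R'). -/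
open Set

lemma wordPrefix_sturmian_succ (α x : ℝ) (n : ℕ) :
    wordPrefix (sturmian α x) (n + 1) =
      (if α ≤ x then true else false) :: wordPrefix (sturmian α (twoIE α x)) n := by
  simp only [wordPrefix, seg, List.range_succ_eq_map, List.map_cons, List.map_map, sturmian,
    Nat.zero_add, Function.iterate_zero, id_eq]
  rfl

lemma wordPrefix_sturmian_add (α x : ℝ) (m n : ℕ) :
    wordPrefix (sturmian α x) (m + n) =
      wordPrefix (sturmian α x) m ++ wordPrefix (sturmian α ((twoIE α)^[m] x)) n := by
  induction m generalizing x with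
  | zero => simp [wordPrefix, seg]
  | succ m ih =>
    rw [Nat.add_right_comm, wordPrefix_sturmian_succ, wordPrefix_sturmian_succ, ih]
    simp

lemma twoIE_iterate_nonneg {α x : ℝ} (hα : α ≤ 1) (hx : 0 ≤ x) (n : ℕ) :
    0 ≤ (twoIE α)^[n] x := by
  induction n generalizing x with
  | zero => simpa
  | succ n ih =>
    rw [Function.iterate_succ_apply]
    apply ih
    unfold twoIE
    split_ifs <;> linarith

/-- The iterates of `twoIE α` are rotations by multiples of `-α` modulo `1`. -/
lemma exists_twoIE_iterate_eq (α x : ℝ) (n : ℕ) :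
    ∃ p : ℤ, (twoIE α)^[n] x = x + (p - n * α) := by
  induction n generalizing x with
  | zero => exact ⟨0, by simp⟩
  | succ n ih =>
    obtain ⟨p, hp⟩ := ih (twoIE α x)
    rw [Function.iterate_succ_apply, hp]
    unfold twoIE
    split_ifs
    · exact ⟨p + 1, by push_cast; ring⟩
    · exact ⟨p, by push_cast; ring⟩

/-- Codings are monotone: for `x ≤ y`, either the coding of `x` is lexicographically smaller,
or the coding of `y` is a prefix of it and the two orbits stay at constant distance. -/
lemma lex_wordPrefix_or {α x y : ℝ} (hxy : x ≤ y) (n m : ℕ) :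
    List.Lex (· < ·) (wordPrefix (sturmian α x) n) (wordPrefix (sturmian α y) m) ∨
      (twoIE α)^[m] y - (twoIE α)^[m] x = y - x := by
  induction m generalizing x y n with
  | zero => right; simp
  | succ m ih =>
    rw [wordPrefix_sturmian_succ α y]
    cases n with
    | zero => left; simp [wordPrefix, seg]
    | succ n =>
      rw [wordPrefix_sturmian_succ α x, Function.iterate_succ_apply, Function.iterate_succ_apply]
      by_cases hx : α ≤ x
      · have hy : α ≤ y := hx.trans hxy
        have h : twoIE α y - twoIE α x = y - x := by
          simp [twoIE, hx.not_gt, hy.not_gt]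
        rw [if_pos hx, if_pos hy]
        rcases ih (x := twoIE α x) (y := twoIE α y) (by linarith) n with h' | h'
        · exact .inl (List.Lex.cons h')
        · exact .inr (h'.trans h)
      · by_cases hy : α ≤ y
        · left
          rw [if_neg hx, if_pos hy]
          exact List.Lex.rel (by decide)
        · have h : twoIE α y - twoIE α x = y - x := by
            simp [twoIE, not_le.mp hx, not_le.mp hy]
          rw [if_neg hx, if_neg hy]
          rcases ih (x := twoIE α x) (y := twoIE α y) (by linarith) n with h' | h'
          · exact .inl (List.Lex.cons h')
          · exact .inr (h'.trans h)

/-- The word `w` codes an orbit segment of `twoIE α` from `x` to `y` which avoids `S`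
strictly between its endpoints. -/
structure CodesPath (α : ℝ) (S : Set ℝ) (w : List Bool) (x y : ℝ) : Prop where
  code : wordPrefix (sturmian α x) w.length = w
  iterate : (twoIE α)^[w.length] x = y
  notMem : ∀ m, 0 < m → m < w.length → (twoIE α)^[m] x ∉ S

namespace CodesPath

variable {α x y z : ℝ} {S S' : Set ℝ} {v w : List Bool}

lemma mono (h : CodesPath α S w x y) (hS : S' ⊆ S) : CodesPath α S' w x y :=
  ⟨h.code, h.iterate, fun m h0 hm hmem => h.notMem m h0 hm (hS hmem)⟩

lemma append (h : CodesPath α S v x y) (h' : CodesPath α S w y z) (hy : y ∉ S) :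
    CodesPath α S (v ++ w) x z where
  code := by
    rw [List.length_append, wordPrefix_sturmian_add, h.code, h.iterate, h'.code]
  iterate := by
    rw [List.length_append, Nat.add_comm, Function.iterate_add_apply, h.iterate, h'.iterate]
  notMem m h0 hm := by
    rw [List.length_append] at hm
    rcases lt_trichotomy m v.length with hlt | heq | hgt
    · exact h.notMem m h0 hlt
    · rw [heq, h.iterate]
      exact hy
    · obtain ⟨k, rfl⟩ := Nat.exists_eq_add_of_lt hgt
      have h1 := h'.notMem (k + 1) (by omega) (by omega)
      rwa [show v.length + k + 1 = (k + 1) + v.length by omega, Function.iterate_add_apply,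
        h.iterate]

lemma itin_eq (h : CodesPath α S w x y) (hw : 0 < w.length) (hy : y ∈ S) :
    itin α S x = w := by
  have hr : returnTime α S x = w.length := by
    have hmem : w.length ∈ {m : ℕ | 0 < m ∧ (twoIE α)^[m] x ∈ S} := ⟨hw, by rwa [h.iterate]⟩
    refine le_antisymm (Nat.sInf_le hmem) ?_
    by_contra! hlt
    have hmem' := Nat.sInf_mem ⟨_, hmem⟩
    exact h.notMem _ hmem'.1 hlt hmem'.2
  rw [itin, hr, h.code]

end CodesPath

/-- The first return map of `twoIE α` to `[0, a + b)` exchanges the intervals `[0, a)` and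
`[a, a + b)`, whose itineraries are `A` and `B`. -/
structure InducedExchange (α a b : ℝ) (A B : List Bool) : Prop where
  left_pos : 0 < a
  right_pos : 0 < b
  left_length_pos : 0 < A.length
  right_length_pos : 0 < B.length
  /-- The return times to `[0, a + b)` have total integral one. -/
  kac : a * A.length + b * B.length = 1
  left : ∀ x, 0 ≤ x → x < a → CodesPath α (Ico 0 (a + b)) A x (x + b)
  right : ∀ x, a ≤ x → x < a + b → CodesPath α (Ico 0 (a + b)) B x (x - a)

namespace InducedExchange

variable {α a b : ℝ} {A B : List Bool}

lemma base (hα : α ∈ Ioo (0 : ℝ) 1) : InducedExchange α α (1 - α) [false] [true] where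
  left_pos := hα.1
  right_pos := by linarith [hα.2]
  left_length_pos := by simp
  right_length_pos := by simp
  kac := by simp
  left x _ h1 := by
    refine ⟨?_, ?_, ?_⟩
    · rw [List.length_singleton, ← Nat.zero_add 1, wordPrefix_sturmian_succ, if_neg h1.not_ge]
      rfl
    · simp [twoIE, h1]; ring
    · intro m h0 hm; simp at hm; omega
  right x h0 _ := by
    refine ⟨?_, ?_, ?_⟩
    · simp [wordPrefix, seg, sturmian, h0]
    · simp [twoIE, h0.not_gt]
    · intro m h0 hm; simp at hm; omega

lemma left_right (h : InducedExchange α a b A B) {x : ℝ} (h0 : 0 ≤ x) (hx : x < a)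
    (hab : a ≤ x + b) {β : ℝ} (hβ : β ≤ x + b) (hL : β ≤ a + b) :
    CodesPath α (Ico 0 β) (A ++ B) x (x + b - a) := by
  have hS : Ico 0 β ⊆ Ico 0 (a + b) := Ico_subset_Ico_right hL
  exact ((h.left x h0 hx).mono hS).append ((h.right (x + b) hab (by linarith)).mono hS)
    (fun hm => hβ.not_gt hm.2)

lemma induce_left (h : InducedExchange α a b A B) (hab : b < a) :
    InducedExchange α (a - b) b A (A ++ B) where
  left_pos := by linarith
  right_pos := h.right_pos
  left_length_pos := h.left_length_pos
  right_length_pos := by have := h.left_length_pos; simp only [List.length_append]; omega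
  kac := by rw [← h.kac, List.length_append]; push_cast; ring
  left x h0 hx := (h.left x h0 (by linarith [h.right_pos])).mono
    (Ico_subset_Ico_right (by linarith [h.right_pos]))
  right x h0 hx := by
    have h1 := h.left_right (β := a - b + b) (x := x) (by linarith) (by linarith) (by linarith)
      (by linarith) (by linarith [h.right_pos])
    rwa [show x + b - a = x - (a - b) by ring] at h1

lemma induce_right (h : InducedExchange α a b A B) (hab : a < b) :
    InducedExchange α a (b - a) (A ++ B) B where
  left_pos := h.left_pos
  right_pos := by linarith
  left_length_pos := by have := h.left_length_pos; simp only [List.length_append]; omega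
  right_length_pos := h.right_length_pos
  kac := by rw [← h.kac, List.length_append]; push_cast; ring
  left x h0 hx := by
    have h1 := h.left_right (β := a + (b - a)) (x := x) h0 hx (by linarith)
      (by linarith) (by linarith [h.left_pos])
    rwa [show x + b - a = x + (b - a) by ring] at h1
  right x h0 hx := (h.right x h0 (by linarith [h.left_pos])).mono
    (Ico_subset_Ico_right (by linarith [h.left_pos]))

lemma ne (h : InducedExchange α a b A B) (hirr : Irrational α) : a ≠ b := by
  rintro rfl
  have h1 := (h.left_right (β := a) le_rfl h.left_pos (by simp) (by simp)
    (by linarith [h.left_pos])).iterate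
  obtain ⟨p, hp⟩ := exists_twoIE_iterate_eq α 0 (A ++ B).length
  rw [hp] at h1
  have hn : (A ++ B).length ≠ 0 := by
    have := h.left_length_pos
    simp only [List.length_append]
    omega
  exact (hirr.natCast_mul hn).ne_int p (by linarith)

lemma lex (h : InducedExchange α a b A B) (hα : α ≤ 1) : List.Lex (· < ·) A B := by
  have hA := (h.left 0 le_rfl h.left_pos).code
  have hB := h.right a le_rfl (by linarith [h.right_pos])
  rcases lex_wordPrefix_or (α := α) h.left_pos.le A.length B.length with h1 | h1
  · rwa [hA, hB.code] at h1
  · rw [hB.iterate] at h1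
    linarith [twoIE_iterate_nonneg hα le_rfl B.length, h.left_pos]

lemma itin_mem (h : InducedExchange α a b A B) {β : ℝ} (ha : a ≤ β) (hb : b ≤ β)
    (hL : β ≤ a + b) {x : ℝ} (hx : x ∈ Ico 0 β) :
    itin α (Ico 0 β) x ∈ ({A, B, A ++ B} : Set (List Bool)) := by
  have hS : Ico 0 β ⊆ Ico 0 (a + b) := Ico_subset_Ico_right hL
  obtain ⟨h0, hxβ⟩ := hx
  have hb0 := h.right_pos
  rcases lt_or_ge x a with hxa | hxa
  · rcases lt_or_ge (x + b) β with hxb | hxb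
    · left
      exact ((h.left x h0 hxa).mono hS).itin_eq h.left_length_pos ⟨by linarith, hxb⟩
    · right; right
      refine (h.left_right h0 hxa (by linarith) hxb hL).itin_eq ?_ ⟨by linarith, by linarith⟩
      have := h.left_length_pos
      simp only [List.length_append]
      omega
  · right; left
    exact ((h.right x hxa (by linarith)).mono hS).itin_eq h.right_length_pos
      ⟨by linarith, by linarith [h.left_pos]⟩

lemma exists_right_eq (h : InducedExchange α a b A B) :
    ∃ p : ℤ, b = p - A.length * α := by
  obtain ⟨p, hp⟩ := exists_twoIE_iterate_eq α 0 A.length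
  rw [(h.left 0 le_rfl h.left_pos).iterate] at hp
  exact ⟨p, by linarith⟩

lemma exists_left_eq (h : InducedExchange α a b A B) :
    ∃ p : ℤ, -a = p - B.length * α := by
  obtain ⟨p, hp⟩ := exists_twoIE_iterate_eq α a B.length
  rw [(h.right a le_rfl (by linarith [h.right_pos])).iterate] at hp
  exact ⟨p, by linarith⟩

end InducedExchange

lemma Irrational.exists_forall_le_abs_sub {α : ℝ} (hirr : Irrational α) (N : ℕ) :
    ∃ δ > 0, ∀ q : ℕ, 0 < q → q ≤ N → ∀ p : ℤ, δ ≤ |(p : ℝ) - q * α| := by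
  induction N with
  | zero => exact ⟨1, one_pos, fun q h0 hq => by omega⟩
  | succ N ih =>
    obtain ⟨δ, hδ, h⟩ := ih
    have hN : Irrational (((N + 1 : ℕ) : ℝ) * α) := hirr.natCast_mul (by omega)
    refine ⟨min δ |((N + 1 : ℕ) : ℝ) * α - round (((N + 1 : ℕ) : ℝ) * α)|,
      lt_min hδ (abs_pos.2 (sub_ne_zero.2 (hN.ne_int _))), fun q h0 hq p => ?_⟩
    rcases Nat.lt_or_ge N q with hlt | hle
    · obtain rfl : q = N + 1 := by omega
      rw [abs_sub_comm (p : ℝ)]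
      exact (min_le_right _ _).trans (round_le _ _)
    · exact (min_le_left _ _).trans (h q h0 hle p)

/-- Repeated induction reaches an exchange whose two intervals are no longer than `β`. -/
lemma InducedExchange.exists_le {α β : ℝ} (hirr : Irrational α) (hβ : 0 < β)
    {a b : ℝ} {A B : List Bool} (h : InducedExchange α a b A B) (hL : β ≤ a + b) :
    ∃ a' b' A' B', InducedExchange α a' b' A' B' ∧ a' ≤ β ∧ b' ≤ β ∧ β ≤ a' + b' := by
  obtain ⟨N, hN⟩ := exists_nat_gt (1 / β)
  rw [div_lt_iff₀ hβ] at hN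
  obtain ⟨δ, hδ, hδN⟩ := hirr.exists_forall_le_abs_sub N
  obtain ⟨k, hk⟩ := exists_nat_gt ((a + b) / δ)
  rw [div_lt_iff₀ hδ] at hk
  induction k generalizing a b A B with
  | zero => simp at hk; linarith
  | succ k ih =>
    push_cast at hk
    have ha0 := h.left_pos
    have hb0 := h.right_pos
    have hkac := h.kac
    rcases lt_or_gt_of_ne (h.ne hirr) with hab | hab
    · by_cases hbβ : b ≤ β
      · exact ⟨a, b, A, B, h, by linarith, hbβ, hL⟩
      · have hB : B.length ≤ N := by
          have h1 : 0 ≤ a * A.length := by positivity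
          have h2 : β * B.length ≤ b * B.length := by gcongr; linarith
          have h3 : (B.length : ℝ) * β ≤ N * β := by linarith
          exact_mod_cast le_of_mul_le_mul_right h3 hβ
        obtain ⟨p, hp⟩ := h.exists_left_eq
        have hδa := hδN _ h.right_length_pos hB p
        rw [← hp, abs_neg, abs_of_pos ha0] at hδa
        exact ih (h.induce_right hab) (by linarith) (by linarith)
    · by_cases haβ : a ≤ β
      · exact ⟨a, b, A, B, h, haβ, by linarith, hL⟩
      · have hA : A.length ≤ N := by
          have h1 : 0 ≤ b * B.length := by positivity
          have h2 : β * A.length ≤ a * A.length := by gcongr; linarith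
          have h3 : (A.length : ℝ) * β ≤ N * β := by linarith
          exact_mod_cast le_of_mul_le_mul_right h3 hβ
        obtain ⟨p, hp⟩ := h.exists_right_eq
        have hδb := hδN _ h.left_length_pos hA p
        rw [← hp, abs_of_pos hb0] at hδb
        exact ih (h.induce_left hab) (by linarith) (by linarith)

/-- for `I = [0,β)` with `0 < β ≤ 1` there exist words `R ≺_lex R'`
such that every `I`-itinerary belongs to `{R, R', RR'}`. -/
theorem itinerary_in_triple (α : ℝ) (hα : α ∈ Set.Ioo (0:ℝ) 1)
    (hirr : Irrational α) (β : ℝ) (hβ : 0 < β) (hβ1 : β ≤ 1) :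
    ∃ R R' : List Bool, List.Lex (· < ·) R R' ∧
      ∀ x ∈ Set.Ico (0:ℝ) β,
        itin α (Set.Ico (0:ℝ) β) x ∈ ({R, R', R ++ R'} : Set (List Bool)) := by
  obtain ⟨a, b, A, B, h, ha, hb, hL⟩ :=
    (InducedExchange.base hα).exists_le hirr hβ (by linarith)
  exact ⟨A, B, h.lex hα.2.le, fun x hx => h.itin_mem ha hb hL hx⟩
end

section
/- Let α, ρ ∈ (0,1) with α irrational and let u = u_{α,ρ}. If a factor w of u has exactly three abelian return words, then there exist finite binary words R₁ and R₂ such that AR_{w,u} = {R₁, R₂, R₁R₂}; in particular, if the three abelian return words have lengths l₁ ≤ l₂ ≤ l₃, then l₁ + l₂ = l₃. -/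
open Set

/-- The rotation coding of a real point `x`, taken modulo `1`. -/
noncomputable def rotWord (α x : ℝ) (n : ℕ) : List Bool :=
  (List.range n).map fun k : ℕ => decide (α ≤ Int.fract (x - k * α))

lemma twoIE_iterate {α x : ℝ} (hα : α ∈ Ioo (0:ℝ) 1) (hx : x ∈ Ico (0:ℝ) 1) (n : ℕ) :
    (twoIE α)^[n] x = Int.fract (x - n * α) := by
  induction n with
  | zero => simpa using (Int.fract_eq_self.2 hx).symm
  | succ n ih =>
    rw [Function.iterate_succ_apply', ih]
    obtain ⟨h0, h1⟩ := hα
    have e := Int.floor_add_fract (x - n * α)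
    have f0 := Int.fract_nonneg (x - n * α)
    have f1 := Int.fract_lt_one (x - n * α)
    symm
    unfold twoIE
    split_ifs with h
    · rw [Int.fract_eq_iff]
      refine ⟨by linarith, by linarith, ⌊x - n * α⌋ - 1, ?_⟩
      push_cast; linarith
    · rw [Int.fract_eq_iff]
      refine ⟨by linarith, by linarith, ⌊x - n * α⌋, ?_⟩
      push_cast; linarith

lemma floor_sub_step {α : ℝ} (hα : α ∈ Ioo (0:ℝ) 1) (t : ℝ) :
    ⌊t - α⌋ = if α ≤ Int.fract t then ⌊t⌋ else ⌊t⌋ - 1 := by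
  obtain ⟨h0, h1⟩ := hα
  have e := Int.floor_add_fract t
  have f0 := Int.fract_nonneg t
  have f1 := Int.fract_lt_one t
  split_ifs with h
  · rw [Int.floor_eq_iff]; constructor <;> linarith
  · rw [Int.floor_eq_iff]; push_cast; constructor <;> linarith

lemma rotWord_add (α x : ℝ) (m n : ℕ) :
    rotWord α x (m + n) = rotWord α x m ++ rotWord α (x - m * α) n := by
  unfold rotWord
  rw [List.range_add, List.map_append, List.map_map]
  congr 1
  refine List.map_congr_left fun k _ => ?_
  have : x - ((m + k : ℕ) : ℝ) * α = x - m * α - k * α := by push_cast; ring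
  simp only [Function.comp, this]

lemma rotWord_add_int (α x : ℝ) (z : ℤ) (n : ℕ) :
    rotWord α (x + z) n = rotWord α x n := by
  unfold rotWord
  refine List.map_congr_left fun k _ => ?_
  rw [show x + z - k * α = x - k * α + z by ring, Int.fract_add_intCast]

lemma rotWord_fract (α x : ℝ) (n : ℕ) : rotWord α (Int.fract x) n = rotWord α x n := by
  have := rotWord_add_int α (Int.fract x) ⌊x⌋ n
  rw [Int.fract_add_floor] at this
  exact this.symm

lemma seg_sturmian {α ρ : ℝ} (hα : α ∈ Ioo (0:ℝ) 1) (hρ : ρ ∈ Ico (0:ℝ) 1) (i n : ℕ) :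
    seg (sturmian α ρ) i n = rotWord α (Int.fract (ρ - i * α)) n := by
  rw [rotWord_fract]
  unfold seg rotWord sturmian
  refine List.map_congr_left fun k _ => ?_
  rw [twoIE_iterate hα hρ,
    show ρ - ((i + k : ℕ) : ℝ) * α = ρ - i * α - k * α by push_cast; ring]
  by_cases h : α ≤ Int.fract (ρ - i * α - k * α) <;> simp [h]

lemma count_rotWord {α : ℝ} (hα : α ∈ Ioo (0:ℝ) 1) (x : ℝ) (n : ℕ) :
    ((rotWord α x n).count false : ℤ) = ⌊x⌋ - ⌊x - n * α⌋ := by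
  induction n with
  | zero => simp [rotWord]
  | succ n ih =>
    have hs : rotWord α x (n + 1) = rotWord α x n ++ [decide (α ≤ Int.fract (x - n * α))] := by
      simp [rotWord, List.range_succ]
    rw [hs, List.count_append, Nat.cast_add, ih,
      show x - ((n + 1 : ℕ) : ℝ) * α = x - n * α - α by push_cast; ring, floor_sub_step hα]
    by_cases h : α ≤ Int.fract (x - n * α)
    · simp [h]
    · simp [h]; ring

lemma rotWord_congr {α x y : ℝ} (hα : α ∈ Ioo (0:ℝ) 1) {m : ℕ}
    (h : ∀ k ≤ m, ⌊x - k * α⌋ = ⌊y - k * α⌋) : rotWord α x m = rotWord α y m := by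
  refine List.map_congr_left fun k hk => ?_
  have hk : k < m := List.mem_range.1 hk
  have h1 := h k hk.le
  have h2 := h (k + 1) hk
  rw [show x - ((k + 1 : ℕ) : ℝ) * α = x - k * α - α by push_cast; ring,
    show y - ((k + 1 : ℕ) : ℝ) * α = y - k * α - α by push_cast; ring,
    floor_sub_step hα, floor_sub_step hα, h1] at h2
  refine decide_eq_decide.2 ?_
  by_cases ha : α ≤ Int.fract (x - k * α) <;> by_cases hb : α ≤ Int.fract (y - k * α) <;>
    simp only [ha, hb, if_true, if_false] at h2 ⊢ <;> omega

/-- Two nearby points whose integer parts differ are separated by an integer. -/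
lemma fract_of_floor_ne {s t : ℝ} (h1 : s ≤ t) (h2 : t < s + 1) (h : ⌊s⌋ ≠ ⌊t⌋) :
    Int.fract t < t - s ∧ 1 - (t - s) ≤ Int.fract s := by
  have hs := Int.floor_add_fract s
  have ht := Int.floor_add_fract t
  have := Int.fract_nonneg t
  have := Int.fract_nonneg s
  have := Int.fract_lt_one t
  have := Int.fract_lt_one s
  have hle : ⌊s⌋ + 1 ≤ ⌊t⌋ := lt_of_le_of_ne (Int.floor_mono h1) h
  have hle' : (⌊s⌋ : ℝ) + 1 ≤ ⌊t⌋ := by exact_mod_cast hle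
  have hge : ⌊t⌋ < ⌊s⌋ + 2 := by
    have : (⌊t⌋ : ℝ) < ⌊s⌋ + 2 := by linarith
    exact_mod_cast this
  have hee : ⌊t⌋ = ⌊s⌋ + 1 := by omega
  have hee' : (⌊t⌋ : ℝ) = ⌊s⌋ + 1 := by exact_mod_cast hee
  constructor <;> linarith

lemma exists_wrap {δ ε : ℝ} (hδ : 0 < δ) (hδε : δ < ε) (hδ1 : δ < 1)
    (hne : ∀ N : ℕ, 0 < N → ∀ k : ℤ, (N : ℝ) * δ ≠ k) :
    ∃ N : ℕ, 0 < N ∧ 0 < 1 - N * δ ∧ 1 - N * δ < ε := by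
  have h1 : (1 : ℝ) ≤ 1 / δ := by rw [le_div_iff₀ hδ]; linarith
  have hpos : 0 < ⌊1 / δ⌋₊ := Nat.floor_pos.2 h1
  refine ⟨⌊1 / δ⌋₊, hpos, ?_, ?_⟩
  · have := Nat.floor_le (zero_le_one.trans h1)
    rw [le_div_iff₀ hδ] at this
    have h' := hne _ hpos 1
    push_cast at h'
    have := lt_of_le_of_ne this h'
    linarith
  · have := Nat.lt_floor_add_one (1 / δ)
    rw [div_lt_iff₀ hδ] at this
    linarith

lemma Irrational.nat_mul_ne_int {α : ℝ} (hirr : Irrational α) {m : ℕ} (hm : 0 < m) (k : ℤ) :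
    (m : ℝ) * α ≠ k :=
  (hirr.natCast_mul hm.ne').ne_int k

/-- Multiples of an irrational approach the integers from both sides. -/
lemma exists_both_sides {α ε : ℝ} (hirr : Irrational α) (hε : 0 < ε) :
    (∃ m : ℕ, 0 < m ∧ ∃ k : ℤ, 0 < k - m * α ∧ k - m * α < ε) ∧
    (∃ m : ℕ, 0 < m ∧ ∃ k : ℤ, 0 < m * α - k ∧ m * α - k < ε) := by
  obtain ⟨n, hn⟩ := exists_nat_one_div_lt hε
  obtain ⟨j, k, hk, -, hjk⟩ := Real.exists_int_int_abs_mul_sub_le α (Nat.succ_pos n)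
  lift k to ℕ using hk.le
  have hk : 0 < k := by exact_mod_cast hk
  have hlt : |(k : ℝ) * α - j| < min ε 1 := by
    have h1 : (1 : ℝ) / ((n.succ : ℕ) + 1) < 1 / ((n : ℝ) + 1) := by
      apply one_div_lt_one_div_of_lt <;> push_cast <;> [positivity; linarith]
    have h2 : (1 : ℝ) / ((n : ℝ) + 1) ≤ 1 := by
      rw [div_le_one (by positivity)]
      have : (0 : ℝ) ≤ n := n.cast_nonneg
      linarith
    refine lt_min ?_ ?_
    · calc _ ≤ _ := by exact_mod_cast hjk
        _ < _ := h1
        _ < ε := hn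
    · calc _ ≤ _ := by exact_mod_cast hjk
        _ < _ := h1
        _ ≤ 1 := h2
  have hlt1 := hlt.trans_le (min_le_left _ _)
  have hlt2 := hlt.trans_le (min_le_right _ _)
  have hne := hirr.nat_mul_ne_int hk j
  have hmul : ∀ N : ℕ, 0 < N → ∀ z : ℤ, (N : ℝ) * (k * α - j) ≠ z := by
    intro N hN z h
    apply hirr.nat_mul_ne_int (Nat.mul_pos hN hk) (z + N * j)
    push_cast; linarith
  rcases lt_or_gt_of_ne hne with h | h
  · rw [abs_of_neg (by linarith)] at hlt1 hlt2
    obtain ⟨N, hN, a, b⟩ := exists_wrap (ε := ε) (δ := j - k * α) (by linarith) (by linarith)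
      (by linarith) (by
        intro N hN z h
        apply hmul N hN (-z)
        push_cast; linarith)
    refine ⟨⟨k, hk, j, by linarith, by linarith⟩,
      ⟨N * k, Nat.mul_pos hN hk, N * j - 1, ?_, ?_⟩⟩ <;> push_cast <;> linarith
  · rw [abs_of_pos (by linarith)] at hlt1 hlt2
    obtain ⟨N, hN, a, b⟩ := exists_wrap (ε := ε) (δ := k * α - j) (by linarith) (by linarith)
      (by linarith) hmul
    refine ⟨⟨N * k, Nat.mul_pos hN hk, N * j + 1, ?_, ?_⟩,
      ⟨k, hk, j, by linarith, by linarith⟩⟩ <;> push_cast <;> linarith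

/-- The first displacements, to the right by `p` and to the left by `q`, that are shorter
than `L` for the rotation by `-α`. -/
structure FirstSteps (α L : ℝ) (mp mq : ℕ) (kp kq : ℤ) (p q : ℝ) : Prop where
  mp_pos : 0 < mp
  mq_pos : 0 < mq
  p_eq : p = kp - mp * α
  q_eq : q = mq * α - kq
  p_pos : 0 < p
  q_pos : 0 < q
  p_lt : p < L
  q_lt : q < L
  mp_min : ∀ m : ℕ, 0 < m → ∀ k : ℤ, 0 < k - m * α → k - m * α < L → mp ≤ m
  mq_min : ∀ m : ℕ, 0 < m → ∀ k : ℤ, 0 < m * α - k → m * α - k < L → mq ≤ m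

lemma exists_firstSteps {α L : ℝ} (hirr : Irrational α) (hL : 0 < L) :
    ∃ mp mq kp kq p q, FirstSteps α L mp mq kp kq p q := by
  classical
  obtain ⟨hp, hq⟩ := exists_both_sides hirr hL
  obtain ⟨mp0, kp, hp1, hp2⟩ := Nat.find_spec hp
  obtain ⟨mq0, kq, hq1, hq2⟩ := Nat.find_spec hq
  exact ⟨_, _, kp, kq, _, _, mp0, mq0, rfl, rfl, hp1, hq1, hp2, hq2,
    fun m hm k h1 h2 => Nat.find_min' hp ⟨hm, k, h1, h2⟩,
    fun m hm k h1 h2 => Nat.find_min' hq ⟨hm, k, h1, h2⟩⟩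

namespace FirstSteps

variable {α L p q : ℝ} {mp mq : ℕ} {kp kq : ℤ}

lemma le_add (S : FirstSteps α L mp mq kp kq p q) (hL : L < 1) : L ≤ p + q := by
  by_contra! h
  obtain ⟨_, _, ep, eq, _, _, _, _, h1, h2⟩ := S
  rcases lt_trichotomy mp mq with hlt | heq | hlt
  · have := h2 (mq - mp) (by omega) (kq - kp)
    rw [Nat.cast_sub hlt.le] at this
    push_cast at this
    have := this (by linarith) (by linarith)
    omega
  · subst heq
    have a : (0 : ℝ) < ((kp - kq : ℤ) : ℝ) := by push_cast; linarith
    have b : ((kp - kq : ℤ) : ℝ) < 1 := by push_cast; linarith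
    have a' : 0 < kp - kq := by exact_mod_cast a
    have b' : kp - kq < 1 := by exact_mod_cast b
    omega
  · have := h1 (mp - mq) (by omega) (kp - kq)
    rw [Nat.cast_sub hlt.le] at this
    push_cast at this
    have := this (by linarith) (by linarith)
    omega

/-- A right displacement shorter than `p` takes at least `mp + mq` steps. -/
lemma le_of_right (S : FirstSteps α L mp mq kp kq p q) (hL : L < 1) {m : ℕ} (hm : 0 < m)
    {k : ℤ} (h0 : 0 < k - m * α) (h : k - m * α < p) : mp + mq ≤ m := by
  obtain ⟨_, _, ep, eq, _, _, _, _, h1, h2⟩ := S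
  have hle := h1 m hm k h0 (by linarith)
  rcases hle.eq_or_lt with rfl | hlt
  · have a : (0 : ℝ) < ((kp - k : ℤ) : ℝ) := by push_cast; linarith
    have b : ((kp - k : ℤ) : ℝ) < 1 := by push_cast; linarith
    have a' : 0 < kp - k := by exact_mod_cast a
    have b' : kp - k < 1 := by exact_mod_cast b
    omega
  · have := h2 (m - mp) (by omega) (k - kp)
    rw [Nat.cast_sub hle] at this
    push_cast at this
    have := this (by linarith) (by linarith)
    omega

/-- A left displacement shorter than `q` takes at least `mp + mq` steps. -/
lemma le_of_left (S : FirstSteps α L mp mq kp kq p q) (hL : L < 1) {m : ℕ} (hm : 0 < m)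
    {k : ℤ} (h0 : 0 < m * α - k) (h : m * α - k < q) : mp + mq ≤ m := by
  obtain ⟨_, _, ep, eq, _, _, _, _, h1, h2⟩ := S
  have hle := h2 m hm k h0 (by linarith)
  rcases hle.eq_or_lt with rfl | hlt
  · have a : (0 : ℝ) < ((k - kq : ℤ) : ℝ) := by push_cast; linarith
    have b : ((k - kq : ℤ) : ℝ) < 1 := by push_cast; linarith
    have a' : 0 < k - kq := by exact_mod_cast a
    have b' : k - kq < 1 := by exact_mod_cast b
    omega
  · have := h1 (m - mq) (by omega) (k - kq)
    rw [Nat.cast_sub hle] at this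
    push_cast at this
    have := this (by linarith) (by linarith)
    omega

/-- Any return of `x` to `[c, d)` is a short displacement to one of the two sides. -/
lemma return_cases (hirr : Irrational α) {c d x : ℝ} {m : ℕ} (hm : 0 < m)
    (hr : Int.fract (x - m * α) ∈ Ico c d) :
    ∃ k : ℤ, c ≤ x + (k - m * α) ∧ x + (k - m * α) < d ∧
      (0 < k - m * α ∨ 0 < m * α - k) := by
  refine ⟨-⌊x - m * α⌋, ?_, ?_, ?_⟩
  · have := hr.1
    rw [Int.fract] at this
    push_cast; linarith
  · have := hr.2
    rw [Int.fract] at this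
    push_cast; linarith
  · have := hirr.nat_mul_ne_int hm (-⌊x - m * α⌋)
    rcases lt_or_gt_of_ne this with h | h
    · left; linarith
    · right; linarith

lemma le_return_left (S : FirstSteps α L mp mq kp kq p q) (hirr : Irrational α) (hL1 : L < 1)
    {c d x : ℝ} (hL : d - c = L) (hx : x ∈ Ico c d) (hA : x < d - p) {m : ℕ} (hm : 0 < m)
    (hr : Int.fract (x - m * α) ∈ Ico c d) : mp ≤ m := by
  obtain ⟨k, h1, h2, h | h⟩ := return_cases hirr hm hr
  · exact S.mp_min m hm k h (by linarith [hx.1])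
  · have := S.le_add hL1
    have := S.le_of_left hL1 hm h (by linarith)
    omega

lemma le_return_right (S : FirstSteps α L mp mq kp kq p q) (hirr : Irrational α) (hL1 : L < 1)
    {c d x : ℝ} (hL : d - c = L) (hx : x ∈ Ico c d) (hC : c + q ≤ x) {m : ℕ} (hm : 0 < m)
    (hr : Int.fract (x - m * α) ∈ Ico c d) : mq ≤ m := by
  obtain ⟨k, h1, h2, h | h⟩ := return_cases hirr hm hr
  · have := S.le_add hL1
    have := S.le_of_right hL1 hm h (by linarith)
    omega
  · exact S.mq_min m hm k h (by linarith [hx.2])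

lemma le_return_middle (S : FirstSteps α L mp mq kp kq p q) (hirr : Irrational α) (hL1 : L < 1)
    {c d x : ℝ} (hA : d - p ≤ x) (hC : x < c + q)
    {m : ℕ} (hm : 0 < m) (hr : Int.fract (x - m * α) ∈ Ico c d) : mp + mq ≤ m := by
  obtain ⟨k, h1, h2, h | h⟩ := return_cases hirr hm hr
  · exact S.le_of_right hL1 hm h (by linarith)
  · exact S.le_of_left hL1 hm h (by linarith)

lemma sub_mp (S : FirstSteps α L mp mq kp kq p q) (x : ℝ) :
    x - mp * α = x + p + (-kp : ℤ) := by
  rw [S.p_eq]; push_cast; ring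

lemma sub_mq (S : FirstSteps α L mp mq kp kq p q) (x : ℝ) :
    x - mq * α = x - q + (-kq : ℤ) := by
  rw [S.q_eq]; push_cast; ring

lemma sub_add (S : FirstSteps α L mp mq kp kq p q) (x : ℝ) :
    x - (mp + mq : ℕ) * α = x + p - q + (-kp - kq : ℤ) := by
  rw [S.p_eq, S.q_eq]; push_cast; ring

lemma fract_sub_mp (S : FirstSteps α L mp mq kp kq p q) {x : ℝ} (h : x + p ∈ Ico (0:ℝ) 1) :
    Int.fract (x - mp * α) = x + p := by
  rw [S.sub_mp, Int.fract_add_intCast, Int.fract_eq_self.2 h]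

lemma fract_sub_mq (S : FirstSteps α L mp mq kp kq p q) {x : ℝ} (h : x - q ∈ Ico (0:ℝ) 1) :
    Int.fract (x - mq * α) = x - q := by
  rw [S.sub_mq, Int.fract_add_intCast, Int.fract_eq_self.2 h]

lemma floor_sub_mp (S : FirstSteps α L mp mq kp kq p q) {x : ℝ} (h : x + p ∈ Ico (0:ℝ) 1) :
    ⌊x - mp * α⌋ = -kp := by
  rw [S.sub_mp, Int.floor_add_intCast, Int.floor_eq_zero_iff.2 h, zero_add]

lemma floor_sub_mq (S : FirstSteps α L mp mq kp kq p q) {x : ℝ} (h : x - q ∈ Ico (0:ℝ) 1) :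
    ⌊x - mq * α⌋ = -kq := by
  rw [S.sub_mq, Int.floor_add_intCast, Int.floor_eq_zero_iff.2 h, zero_add]

/-- The first return time to `[c, d)` on each of the three subintervals. -/
lemma return_time (S : FirstSteps α L mp mq kp kq p q) (hirr : Irrational α) (hL1 : L < 1)
    {c d x : ℝ} (hL : d - c = L) (hc : 0 ≤ c) (hd : d ≤ 1) (hx : x ∈ Ico c d) {m : ℕ}
    (hm : 0 < m) (hr : Int.fract (x - m * α) ∈ Ico c d)
    (hfirst : ∀ k : ℕ, 0 < k → k < m → Int.fract (x - k * α) ∉ Ico c d) :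
    (x < d - p ∧ m = mp) ∨ (c + q ≤ x ∧ m = mq) ∨
      (d - p ≤ x ∧ x < c + q ∧ m = mp + mq) := by
  have hp := S.p_pos
  have hq := S.q_pos
  obtain ⟨hx0, hx1⟩ := hx
  rcases lt_or_ge x (d - p) with hA | hA
  · refine Or.inl ⟨hA, le_antisymm ?_ (S.le_return_left hirr hL1 hL ⟨hx0, hx1⟩ hA hm hr)⟩
    by_contra! h
    refine hfirst mp S.mp_pos h ?_
    rw [S.fract_sub_mp ⟨by linarith, by linarith⟩]
    exact ⟨by linarith, by linarith⟩
  rcases le_or_gt (c + q) x with hC | hC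
  · refine Or.inr (Or.inl ⟨hC, le_antisymm ?_
      (S.le_return_right hirr hL1 hL ⟨hx0, hx1⟩ hC hm hr)⟩)
    by_contra! h
    refine hfirst mq S.mq_pos h ?_
    rw [S.fract_sub_mq ⟨by linarith, by linarith⟩]
    exact ⟨by linarith, by linarith⟩
  · refine Or.inr (Or.inr ⟨hA, hC, le_antisymm ?_
      (S.le_return_middle hirr hL1 hA hC hm hr)⟩)
    by_contra! h
    have := S.p_lt
    have := S.q_lt
    refine hfirst (mp + mq) (Nat.add_pos_left S.mp_pos _) h ?_
    rw [S.sub_add, Int.fract_add_intCast, Int.fract_eq_self.2 ⟨by linarith, by linarith⟩]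
    exact ⟨by linarith, by linarith⟩

end FirstSteps

lemma rotWord_eq_of_fract {α x y : ℝ} (hα : α ∈ Ioo (0:ℝ) 1) (hx : x ∈ Ico (0:ℝ) 1)
    (hy : y ∈ Ico (0:ℝ) 1) (hxy : x ≤ y) {m : ℕ} (hend : ⌊x - m * α⌋ = ⌊y - m * α⌋)
    (h : ∀ k : ℕ, 0 < k → k < m → Int.fract (y - k * α) < y - x →
      1 - (y - x) ≤ Int.fract (x - k * α) → False) :
    rotWord α x m = rotWord α y m := by
  refine rotWord_congr hα fun k hk => ?_
  rcases hk.eq_or_lt with rfl | hk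
  · exact hend
  rcases Nat.eq_zero_or_pos k with rfl | hk0
  · simp [Int.floor_eq_zero_iff.2 hx, Int.floor_eq_zero_iff.2 hy]
  by_contra hne
  obtain ⟨h1, h2⟩ := fract_of_floor_ne (s := x - k * α) (t := y - k * α) (by linarith)
    (by linarith [hx.1, hy.2]) hne
  exact h k hk0 hk (by linarith) (by linarith)

lemma returns_light {α β : ℝ} (hα : α ∈ Ioo (0:ℝ) 1) (hirr : Irrational α)
    (hβ : β ∈ Ioo (0:ℝ) 1) :
    ∃ R₁ R₂ : List Bool, ∀ x ∈ Ico 0 β, ∀ m : ℕ, 0 < m → Int.fract (x - m * α) ∈ Ico 0 β →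
      (∀ k : ℕ, 0 < k → k < m → Int.fract (x - k * α) ∉ Ico 0 β) →
      rotWord α x m ∈ ({R₁, R₂, R₁ ++ R₂} : Set (List Bool)) := by
  obtain ⟨hβ0, hβ1⟩ := hβ
  obtain ⟨mp, mq, kp, kq, p, q, S⟩ := exists_firstSteps hirr hβ0
  have hp := S.p_pos
  have hq := S.q_pos
  have hpL := S.p_lt
  have hqL := S.q_lt
  refine ⟨rotWord α 0 mp, rotWord α q mq, ?_⟩
  intro x hx m hm hr hfirst
  have ht := S.return_time hirr hβ1 (sub_zero β) le_rfl hβ1.le hx hm hr hfirst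
  obtain ⟨hx0, hx1⟩ := hx
  rcases ht with ⟨hA, rfl⟩ | ⟨hC, rfl⟩ | ⟨hA, hC, rfl⟩
  · left
    refine (rotWord_eq_of_fract hα ⟨le_rfl, one_pos⟩ ⟨hx0, by linarith⟩ hx0 ?_ ?_).symm
    · rw [S.floor_sub_mp ⟨by linarith, by linarith⟩, S.floor_sub_mp ⟨by linarith, by linarith⟩]
    · exact fun k h0 hk h1 _ => hfirst k h0 hk ⟨Int.fract_nonneg _, by linarith⟩
  · right; left
    refine (rotWord_eq_of_fract hα ⟨hq.le, by linarith⟩ ⟨hx0, by linarith⟩ (by linarith)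
      ?_ ?_).symm
    · rw [S.floor_sub_mq ⟨by linarith, by linarith⟩, S.floor_sub_mq ⟨by linarith, by linarith⟩]
    · exact fun k h0 hk h1 _ => hfirst k h0 hk ⟨Int.fract_nonneg _, by linarith⟩
  · right; right
    have hmq := S.mq_pos
    have hxp : x + p < 1 := by
      by_contra! h
      refine hfirst mp S.mp_pos (by omega) ?_
      rw [S.sub_mp, Int.fract_add_intCast, ← Int.fract_sub_one,
        Int.fract_eq_self.2 ⟨by linarith, by linarith⟩]
      exact ⟨by linarith, by linarith⟩
    rw [Set.mem_singleton_iff, rotWord_add, S.sub_mp, rotWord_add_int]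
    congr 1
    · refine (rotWord_eq_of_fract hα ⟨le_rfl, one_pos⟩ ⟨hx0, by linarith⟩ hx0 ?_ ?_).symm
      · rw [S.floor_sub_mp ⟨by linarith, by linarith⟩,
          S.floor_sub_mp ⟨by linarith, by linarith⟩]
      · exact fun k h0 hk h1 _ => hfirst k h0 (by omega) ⟨Int.fract_nonneg _, by linarith⟩
    · refine (rotWord_eq_of_fract hα ⟨hq.le, by linarith⟩ ⟨by linarith, hxp⟩ (by linarith)
        ?_ ?_).symm
      · rw [S.floor_sub_mq ⟨by linarith, by linarith⟩,
          S.floor_sub_mq ⟨by linarith, by linarith⟩]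
      · intro k h0 hk h1 _
        refine hfirst (mp + k) (by omega) (by omega) ?_
        rw [show x - (mp + k : ℕ) * α = x + p - k * α + (-kp : ℤ) by
          rw [S.p_eq]; push_cast; ring, Int.fract_add_intCast]
        exact ⟨Int.fract_nonneg _, by linarith⟩

lemma returns_heavy {α β : ℝ} (hα : α ∈ Ioo (0:ℝ) 1) (hirr : Irrational α)
    (hβ : β ∈ Ioo (0:ℝ) 1) :
    ∃ R₁ R₂ : List Bool, ∀ x ∈ Ico β 1, ∀ m : ℕ, 0 < m → Int.fract (x - m * α) ∈ Ico β 1 →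
      (∀ k : ℕ, 0 < k → k < m → Int.fract (x - k * α) ∉ Ico β 1) →
      rotWord α x m ∈ ({R₁, R₂, R₁ ++ R₂} : Set (List Bool)) := by
  obtain ⟨hβ0, hβ1⟩ := hβ
  have hL1 : 1 - β < 1 := by linarith
  obtain ⟨mp, mq, kp, kq, p, q, S⟩ := exists_firstSteps hirr (sub_pos.2 hβ1)
  have hp := S.p_pos
  have hq := S.q_pos
  have hpL := S.p_lt
  have hqL := S.q_lt
  refine ⟨rotWord α (β + q) mq, rotWord α β mp, ?_⟩
  intro x hx m hm hr hfirst
  have ht := S.return_time hirr hL1 rfl hβ0.le le_rfl hx hm hr hfirst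
  obtain ⟨hx0, hx1⟩ := hx
  rcases ht with ⟨hA, rfl⟩ | ⟨hC, rfl⟩ | ⟨hA, hC, rfl⟩
  · right; left
    refine (rotWord_eq_of_fract hα ⟨hβ0.le, hβ1⟩ ⟨by linarith, hx1⟩ hx0 ?_ ?_).symm
    · rw [S.floor_sub_mp ⟨by linarith, by linarith⟩, S.floor_sub_mp ⟨by linarith, by linarith⟩]
    · intro k h0 hk _ h1
      have := S.le_return_left hirr hL1 rfl (x := β) ⟨le_rfl, hβ1⟩ (by linarith) h0
        ⟨by linarith, Int.fract_lt_one _⟩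
      omega
  · left
    refine (rotWord_eq_of_fract hα ⟨by linarith, by linarith⟩ ⟨by linarith, hx1⟩ hC ?_ ?_).symm
    · rw [S.floor_sub_mq ⟨by linarith, by linarith⟩, S.floor_sub_mq ⟨by linarith, by linarith⟩]
    · intro k h0 hk _ h1
      have := S.le_return_right hirr hL1 rfl (x := β + q) ⟨by linarith, by linarith⟩ le_rfl h0
        ⟨by linarith, Int.fract_lt_one _⟩
      omega
  · right; right
    have hmp := S.mp_pos
    have hxq : 0 ≤ x - q := by
      by_contra! h
      refine hfirst mq S.mq_pos (by omega) ?_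
      rw [S.sub_mq, Int.fract_add_intCast, ← Int.fract_add_one,
        Int.fract_eq_self.2 ⟨by linarith, by linarith⟩]
      exact ⟨by linarith, by linarith⟩
    rw [Set.mem_singleton_iff, add_comm mp mq, rotWord_add, S.sub_mq, rotWord_add_int]
    congr 1
    · refine rotWord_eq_of_fract hα ⟨by linarith, hx1⟩ ⟨by linarith, by linarith⟩ hC.le ?_ ?_
      · rw [S.floor_sub_mq ⟨by linarith, by linarith⟩,
          S.floor_sub_mq ⟨by linarith, by linarith⟩]
      · exact fun k h0 hk _ h1 => hfirst k h0 (by omega) ⟨by linarith, Int.fract_lt_one _⟩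
    · refine rotWord_eq_of_fract hα ⟨hxq, by linarith⟩ ⟨hβ0.le, hβ1⟩ (by linarith) ?_ ?_
      · rw [S.floor_sub_mp ⟨by linarith, by linarith⟩,
          S.floor_sub_mp ⟨by linarith, by linarith⟩]
      · intro k h0 hk _ h1
        refine hfirst (mq + k) (by omega) (by omega) ?_
        rw [show x - (mq + k : ℕ) * α = x - q - k * α + (-kq : ℤ) by
          rw [S.q_eq]; push_cast; ring, Int.fract_add_intCast]
        exact ⟨by linarith, Int.fract_lt_one _⟩

/-- If the occurrences are the visits of the orbit to `I`, the returns are itineraries to `I`. -/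
lemma AR_subset_of_visits {α ρ : ℝ} (hα : α ∈ Ioo (0:ℝ) 1) (hρ : ρ ∈ Ico (0:ℝ) 1)
    {w : List Bool} {I : Set ℝ} {W : Set (List Bool)}
    (hI : ∀ i : ℕ, i ∈ abOcc (sturmian α ρ) w ↔ Int.fract (ρ - i * α) ∈ I)
    (hW : ∀ x ∈ I, ∀ m : ℕ, 0 < m → Int.fract (x - m * α) ∈ I →
      (∀ k : ℕ, 0 < k → k < m → Int.fract (x - k * α) ∉ I) → rotWord α x m ∈ W) :
    AR (sturmian α ρ) w ⊆ W := by
  rintro v ⟨i, j, hi, hj, hij, hfirst, rfl⟩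
  obtain ⟨m, rfl⟩ := Nat.exists_eq_add_of_lt hij
  rw [seg_sturmian hα hρ, show i + m + 1 - i = m + 1 by omega]
  have key : ∀ k : ℕ, Int.fract (Int.fract (ρ - i * α) - k * α) =
      Int.fract (ρ - (i + k : ℕ) * α) := by
    intro k
    rw [show ρ - (i + k : ℕ) * α = Int.fract (ρ - i * α) - k * α + (⌊ρ - i * α⌋ : ℤ) by
      rw [Int.fract]; push_cast; ring, Int.fract_add_intCast]
  refine hW _ ((hI i).1 hi) (m + 1) (Nat.succ_pos m) ?_ ?_
  · rw [key]; exact (hI _).1 hj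
  · intro k h0 hk
    rw [key, ← hI]
    exact hfirst _ (by omega) (by omega)

lemma floor_sub_eq_ite {x t : ℝ} (hx : x ∈ Ico (0:ℝ) 1) :
    ⌊x - t⌋ = if x < Int.fract t then -⌊t⌋ - 1 else -⌊t⌋ := by
  obtain ⟨h0, h1⟩ := hx
  have e := Int.floor_add_fract t
  have := Int.fract_lt_one t
  have := Int.fract_nonneg t
  split_ifs with h <;> rw [Int.floor_eq_iff] <;> push_cast <;> constructor <;> linarith

/-- Two factors of equal length are abelian equivalent exactly when their starting points lie
on the same side of `{nα}`. -/
lemma mem_abOcc_iff {α ρ : ℝ} (hα : α ∈ Ioo (0:ℝ) 1) (hρ : ρ ∈ Ico (0:ℝ) 1)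
    {w : List Bool} {i₀ : ℕ} (hw : seg (sturmian α ρ) i₀ w.length = w) (i : ℕ) :
    i ∈ abOcc (sturmian α ρ) w ↔
      (Int.fract (ρ - i * α) < Int.fract (w.length * α) ↔
        Int.fract (ρ - i₀ * α) < Int.fract (w.length * α)) := by
  have hc : ∀ i : ℕ, ((seg (sturmian α ρ) i w.length).count false : ℤ) =
      -⌊Int.fract (ρ - i * α) - w.length * α⌋ := by
    intro i
    rw [seg_sturmian hα hρ, count_rotWord hα, Int.floor_fract, zero_sub]
  have h1 : i ∈ abOcc (sturmian α ρ) w ↔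
      ((seg (sturmian α ρ) i w.length).count false : ℤ) =
        ((seg (sturmian α ρ) i₀ w.length).count false : ℤ) := by
    rw [hw, Nat.cast_inj]
    simp [abOcc, AbEquiv, seg]
  rw [h1, hc, hc, floor_sub_eq_ite ⟨Int.fract_nonneg _, Int.fract_lt_one _⟩,
    floor_sub_eq_ite ⟨Int.fract_nonneg _, Int.fract_lt_one _⟩]
  by_cases a : Int.fract (ρ - i * α) < Int.fract (w.length * α) <;>
    by_cases b : Int.fract (ρ - i₀ * α) < Int.fract (w.length * α) <;> simp [a, b]

lemma exists_AR_subset {α ρ : ℝ} (hα : α ∈ Ioo (0:ℝ) 1) (hirr : Irrational α)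
    (hρ : ρ ∈ Ico (0:ℝ) 1) {w : List Bool} (hw : IsFactor (sturmian α ρ) w) :
    ∃ R₁ R₂ : List Bool,
      AR (sturmian α ρ) w ⊆ ({R₁, R₂, R₁ ++ R₂} : Set (List Bool)) := by
  rcases Nat.eq_zero_or_pos w.length with h0 | hpos
  · have hocc : ∀ i, i ∈ abOcc (sturmian α ρ) w := by
      rw [List.length_eq_zero_iff] at h0
      subst h0
      simp [abOcc, AbEquiv, seg]
    refine ⟨[false], [true], ?_⟩
    rintro v ⟨i, j, -, -, hij, hfirst, rfl⟩
    have : j - i = 1 := by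
      by_contra h
      exact hfirst (i + 1) (by omega) (by omega) (hocc _)
    rw [this]
    cases hs : sturmian α ρ i <;> simp [seg, hs]
  obtain ⟨i₀, hi₀⟩ := hw
  have hiff := mem_abOcc_iff hα hρ hi₀
  have hβ : Int.fract (w.length * α) ∈ Ioo (0:ℝ) 1 := by
    refine ⟨lt_of_le_of_ne (Int.fract_nonneg _) fun h => ?_, Int.fract_lt_one _⟩
    have := Int.floor_add_fract ((w.length : ℝ) * α)
    rw [← h, add_zero] at this
    exact hirr.nat_mul_ne_int hpos _ this.symm
  by_cases h : Int.fract (ρ - i₀ * α) < Int.fract (w.length * α)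
  · obtain ⟨R₁, R₂, hR⟩ := returns_light hα hirr hβ
    refine ⟨R₁, R₂, AR_subset_of_visits hα hρ (fun i => ?_) hR⟩
    rw [hiff]
    simp [h, Int.fract_nonneg]
  · obtain ⟨R₁, R₂, hR⟩ := returns_heavy hα hirr hβ
    refine ⟨R₁, R₂, AR_subset_of_visits hα hρ (fun i => ?_) hR⟩
    rw [hiff]
    simp only [h, iff_false, not_lt, Set.mem_Ico, Int.fract_lt_one, and_true]

/-- if a factor `w` of a Sturmian word has exactly three abelian
return words, then `AR_{w,u} = {R₁, R₂, R₁R₂}` for some words `R₁, R₂`; in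
particular the lengths `l₁ ≤ l₂ ≤ l₃` of the three abelian returns satisfy
`l₁ + l₂ = l₃`. -/
theorem three_abelian_returns_structure (α ρ : ℝ) (hα : α ∈ Set.Ioo (0:ℝ) 1)
    (hirr : Irrational α) (hρ : ρ ∈ Set.Ioo (0:ℝ) 1)
    (w : List Bool) (hw : IsFactor (sturmian α ρ) w)
    (h3 : (AR (sturmian α ρ) w).ncard = 3) :
    (∃ R₁ R₂ : List Bool,
      AR (sturmian α ρ) w = ({R₁, R₂, R₁ ++ R₂} : Set (List Bool))) ∧
    (∀ v₁ v₂ v₃ : List Bool, v₁ ∈ AR (sturmian α ρ) w → v₂ ∈ AR (sturmian α ρ) w →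
      v₃ ∈ AR (sturmian α ρ) w → v₁ ≠ v₂ → v₁ ≠ v₃ → v₂ ≠ v₃ →
      v₁.length ≤ v₂.length → v₂.length ≤ v₃.length →
      v₁.length + v₂.length = v₃.length) := by
  obtain ⟨R₁, R₂, hsub⟩ := exists_AR_subset hα hirr (Set.Ioo_subset_Ico_self hρ) hw
  have hcard : ({R₁, R₂, R₁ ++ R₂} : Set (List Bool)).ncard ≤ 3 := by
    refine (Set.ncard_insert_le _ _).trans (Nat.succ_le_succ ?_)
    exact (Set.ncard_insert_le _ _).trans (by simp)
  have heq : AR (sturmian α ρ) w = {R₁, R₂, R₁ ++ R₂} :=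
    Set.eq_of_subset_of_ncard_le hsub (h3 ▸ hcard) (Set.toFinite _)
  refine ⟨⟨R₁, R₂, heq⟩, ?_⟩
  have hne : ∀ a b : List Bool, ({a, b} : Set (List Bool)).ncard ≤ 2 := fun a b =>
    (Set.ncard_insert_le _ _).trans (by simp)
  have h₁ : R₁.length ≠ 0 := by
    intro h
    rw [List.length_eq_zero_iff] at h
    subst h
    rw [heq, List.nil_append, Set.pair_eq_singleton] at h3
    have := hne [] R₂
    omega
  have h₂ : R₂.length ≠ 0 := by
    intro h
    rw [List.length_eq_zero_iff] at h
    subst h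
    rw [heq, List.append_nil, Set.insert_comm, Set.pair_eq_singleton] at h3
    have := hne [] R₁
    omega
  have hlen := List.length_append (as := R₁) (bs := R₂)
  rw [heq]
  intro v₁ v₂ v₃ hv₁ hv₂ hv₃ h12 h13 h23 hl hl'
  simp only [Set.mem_insert_iff, Set.mem_singleton_iff] at hv₁ hv₂ hv₃
  rcases hv₁ with rfl | rfl | rfl <;> rcases hv₂ with rfl | rfl | rfl <;>
    rcases hv₃ with rfl | rfl | rfl <;> first | contradiction | omega
end
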